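/- arXiv:1507.01211 — 2 statements merged into one kernel-verified Lean document; each statement's English description precedes it below -/
import Mathlib

section
/- Let ψ : ℝ → ℂ be a smooth function supported in [−1/2, 1/2] with ∫_ℝ ψ = 0, and set ψₖ(x) = 2^k ψ(2^k x) for integers k ≥ 0. There exists a constant C (depending only on ψ) with the following property. Let k ≥ 0, and let m, n be integers with k + m ≥ 0 and k + m + n ≥ 0, let F ⊆ ℤ be a finite set, and let f : ℝ → ℂ be bounded and continuous. Define T f = ∑_{μ∈F} 2^{k+m} (∫_ℝ (ψ_{k+m+n} * f)·h_{k+m,μ}) · (ψₖ * h_{k+m,μ}), and let M f(x) = sup_{r>0} (2r)^{−1} ∫_{x−r}^{x+r} |f(y)| dy denote the (uncentered radius) Hardy–Littlewood maximal function. Then: (a) if m ≥ 0 and −m ≤ n ≤ 0, then for all x ∈ ℝ, |T f(x)| ≤ C · 2^{n−m} · sup_{|y| ≤ 2^{−k+2}} |f(x+y)|; (b) if m ≥ 0 and n < −m, then for all x ∈ ℝ, |T f(x)| ≤ C · 2^{n−m} · M f(x); (c) if m ≤ 0 and n ≤ 0, then for all x ∈ ℝ, |T f(x)| ≤ C ·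 M f(x). -/
open MeasureTheory Real
open scoped ENNReal

noncomputable section

/-- The Haar function $h_{j,\mu}$. -/
def haarFn (j : ℕ) (μ : ℤ) : ℝ → ℂ := fun x =>
  (Set.Ico ((2:ℝ)^(-(j:ℤ)) * μ) ((2:ℝ)^(-(j:ℤ)) * (μ + 1/2))).indicator (fun _ => (1:ℂ)) x
  - (Set.Ico ((2:ℝ)^(-(j:ℤ)) * (μ + 1/2)) ((2:ℝ)^(-(j:ℤ)) * (μ + 1))).indicator (fun _ => (1:ℂ)) x

/-- Convolution $f*g(x)=\int f(t)g(x-t)\,dt$. -/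
def conv (f g : ℝ → ℂ) : ℝ → ℂ := fun x => ∫ t : ℝ, f t * g (x - t)

/-- The dilate $\psi_k(x)=2^k\psi(2^kx)$. -/
def psiDil (ψ : ℝ → ℂ) (k : ℕ) : ℝ → ℂ := fun x => (2:ℂ)^k * ψ ((2:ℝ)^k * x)

/-- The operator $T^k_{m,n}f=\sum_{\mu\in F}2^{k+m}\langle\psi_{k+m+n}*f,h_{k+m,\mu}\rangle\,\psi_k*h_{k+m,\mu}$. -/
def TOp (ψ : ℝ → ℂ) (k : ℕ) (m n : ℤ) (F : Finset ℤ) (f : ℝ → ℂ) : ℝ → ℂ := fun x =>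
  ∑ μ ∈ F, (2:ℂ)^(((k:ℤ) + m).toNat) *
    (∫ y : ℝ, conv (psiDil ψ (((k:ℤ) + m + n).toNat)) f y * haarFn (((k:ℤ) + m).toNat) μ y) *
    conv (psiDil ψ k) (haarFn (((k:ℤ) + m).toNat) μ) x

/-- $\sup_{|y|\le c}|f(x+y)|$. -/
def ballSup (c : ℝ) (f : ℝ → ℂ) (x : ℝ) : ℝ :=
  sSup {t : ℝ | ∃ y : ℝ, |y| ≤ c ∧ t = ‖f (x + y)‖}

/-- The Hardy–Littlewood maximal function $Mf(x)=\sup_{r>0}(2r)^{-1}\int_{x-r}^{x+r}|f|$. -/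
def hlMax (f : ℝ → ℂ) (x : ℝ) : ℝ :=
  sSup {t : ℝ | ∃ r : ℝ, 0 < r ∧ t = (2*r)⁻¹ * ∫ y in Set.Icc (x - r) (x + r), ‖f y‖}

theorem haarFn_eq (j : ℕ) (μ : ℤ) (a d : ℝ) (hd : d = (2:ℝ)^(-(j:ℤ))) (ha : a = d * μ) (x : ℝ) :
    haarFn j μ x = (Set.Ico a (a + d / 2)).indicator (fun _ => (1:ℂ)) x
      - (Set.Ico (a + d / 2) (a + d)).indicator (fun _ => (1:ℂ)) x := by
  have h₁ : d * ((μ:ℝ) + 1/2) = a + d / 2 := by rw [ha]; ring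
  have h₂ : d * ((μ:ℝ) + 1) = a + d := by rw [ha]; ring
  rw [haarFn, ← hd, h₁, h₂, ← ha]

theorem norm_haarFn_le_one (j : ℕ) (μ : ℤ) (x : ℝ) : ‖haarFn j μ x‖ ≤ 1 := by
  rw [haarFn_eq j μ _ _ rfl rfl]
  simp only [Set.indicator, Set.mem_Ico]
  split_ifs with h₁ h₂ <;> first | (exfalso; linarith [h₁.2, h₂.1]) | simp

theorem haarFn_eq_zero {j : ℕ} {μ : ℤ} {x : ℝ}
    (hx : x < (2:ℝ)^(-(j:ℤ)) * μ ∨ (2:ℝ)^(-(j:ℤ)) * μ + (2:ℝ)^(-(j:ℤ)) ≤ x) :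
    haarFn j μ x = 0 := by
  have hd : (0:ℝ) < (2:ℝ)^(-(j:ℤ)) := by positivity
  rw [haarFn_eq j μ _ _ rfl rfl, Set.indicator_of_notMem, Set.indicator_of_notMem, sub_zero]
  · rintro ⟨h₁, h₂⟩
    rcases hx with h | h <;> linarith
  · rintro ⟨h₁, h₂⟩
    rcases hx with h | h <;> linarith

theorem integral_mul_haarFn {g : ℝ → ℂ} (hg : Continuous g) (j : ℕ) (μ : ℤ) (a d : ℝ)
    (hd : d = (2:ℝ)^(-(j:ℤ))) (ha : a = d * μ) :
    ∫ y, g y * haarFn j μ y = ∫ y in a..(a + d / 2), (g y - g (y + d / 2)) := by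
  have hd0 : 0 < d := by rw [hd]; positivity
  have hind : ∀ s : Set ℝ, ∀ y, g y * s.indicator (fun _ => (1:ℂ)) y = s.indicator g y := by
    intro s y
    by_cases h : y ∈ s <;> simp [h]
  have hint : ∀ p q : ℝ, Integrable ((Set.Ico p q).indicator g) := fun p q =>
    (integrable_indicator_iff measurableSet_Ico).2
      (hg.continuousOn.integrableOn_Icc.mono_set Set.Ico_subset_Icc_self)
  have hset : ∀ p q : ℝ, p ≤ q → ∫ y, (Set.Ico p q).indicator g y = ∫ y in p..q, g y := by
    intro p q hpq
    rw [integral_indicator measurableSet_Ico, integral_Ico_eq_integral_Ioc,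
      intervalIntegral.integral_of_le hpq]
  simp_rw [haarFn_eq j μ a d hd ha, mul_sub, hind]
  rw [integral_sub (hint _ _) (hint _ _), hset _ _ (by linarith), hset _ _ (by linarith),
    intervalIntegral.integral_sub (hg.intervalIntegrable _ _)
      ((by fun_prop : Continuous fun y => g (y + d / 2)).intervalIntegrable _ _),
    intervalIntegral.integral_comp_add_right]
  congr 2
  ring

theorem norm_integral_mul_haarFn_le {g : ℝ → ℂ} (hg : Continuous g) (j : ℕ) (μ : ℤ) (a d K : ℝ)
    (hd : d = (2:ℝ)^(-(j:ℤ))) (ha : a = d * μ)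
    (hK : ∀ y ∈ Set.Icc a (a + d / 2), ‖g y - g (y + d / 2)‖ ≤ K) :
    ‖∫ y, g y * haarFn j μ y‖ ≤ K * (d / 2) := by
  have hd0 : 0 < d := by rw [hd]; positivity
  rw [integral_mul_haarFn hg j μ a d hd ha]
  refine (intervalIntegral.norm_integral_le_of_norm_le_const (C := K) fun y hy => ?_).trans ?_
  · rw [Set.uIoc_of_le (by linarith)] at hy
    exact hK y ⟨hy.1.le, hy.2⟩
  · rw [add_sub_cancel_left, abs_of_pos (by linarith)]

theorem conv_eq_integral_sub_left (f g : ℝ → ℂ) (x : ℝ) :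
    conv f g x = ∫ t, f (x - t) * g t := by
  rw [conv, ← integral_sub_left_eq_self (fun t => f (x - t) * g t) volume x]
  simp

theorem continuous_psiDil {ψ : ℝ → ℂ} (hψ : Continuous ψ) (k : ℕ) : Continuous (psiDil ψ k) := by
  unfold psiDil
  fun_prop

theorem psiDil_eq_zero {ψ : ℝ → ℂ} (hsupp : Function.support ψ ⊆ Set.Icc (-(1/2) : ℝ) (1/2))
    (k : ℕ) {t : ℝ} (ht : ((2:ℝ)^k)⁻¹ / 2 < |t|) : psiDil ψ k t = 0 := by
  have h2 : (0:ℝ) < 2^k := by positivity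
  have hz : ψ ((2:ℝ)^k * t) = 0 := by
    by_contra hne
    have hmem := abs_le.2 (hsupp hne)
    rw [abs_mul, abs_of_pos h2] at hmem
    have := mul_lt_mul_of_pos_left ht h2
    rw [mul_div_assoc', mul_inv_cancel₀ h2.ne'] at this
    linarith
  rw [psiDil, hz, mul_zero]

theorem norm_psiDil_sub_le {ψ : ℝ → ℂ} {L : ℝ} (hL : ∀ x y, ‖ψ x - ψ y‖ ≤ L * |x - y|)
    (k : ℕ) (s t : ℝ) : ‖psiDil ψ k s - psiDil ψ k t‖ ≤ L * ((2:ℝ)^k)^2 * |s - t| := by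
  have h2 : (0:ℝ) < 2^k := by positivity
  have h := hL ((2:ℝ)^k * s) ((2:ℝ)^k * t)
  rw [← mul_sub, abs_mul, abs_of_pos h2] at h
  rw [psiDil, psiDil, ← mul_sub, norm_mul, norm_pow, Complex.norm_ofNat]
  calc _ ≤ (2:ℝ)^k * (L * ((2:ℝ)^k * |s - t|)) := by gcongr
    _ = _ := by ring

theorem hasCompactSupport_psiDil {ψ : ℝ → ℂ}
    (hsupp : Function.support ψ ⊆ Set.Icc (-(1/2) : ℝ) (1/2)) (k : ℕ) :
    HasCompactSupport (psiDil ψ k) := by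
  refine HasCompactSupport.intro
    (isCompact_Icc (a := -(((2:ℝ)^k)⁻¹ / 2)) (b := ((2:ℝ)^k)⁻¹ / 2)) fun t ht => ?_
  refine psiDil_eq_zero hsupp k ?_
  by_contra! h
  exact ht (abs_le.1 h)

theorem continuous_conv {f g : ℝ → ℂ} (hfc : HasCompactSupport f) (hf : Continuous f)
    (hg : Continuous g) : Continuous (conv f g) := by
  have := hfc.continuous_convolution_left (ContinuousLinearMap.mul ℝ ℂ) hf
    (hg.locallyIntegrable (μ := volume))
  exact this

/-- Moving a smoothed function by `δ` costs a factor `L * 2 ^ (2 * l) * δ`. -/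
theorem norm_conv_psiDil_sub_le {ψ : ℝ → ℂ} {L : ℝ} (hψ : Continuous ψ)
    (hL : ∀ x y, ‖ψ x - ψ y‖ ≤ L * |x - y|)
    (hsupp : Function.support ψ ⊆ Set.Icc (-(1/2) : ℝ) (1/2)) (l : ℕ)
    {f : ℝ → ℂ} (hf : Continuous f) (a δ : ℝ) (hδ : 0 ≤ δ) {y : ℝ} (hy : y ∈ Set.Icc a (a + δ)) :
    ‖conv (psiDil ψ l) f y - conv (psiDil ψ l) f (y + δ)‖ ≤
      L * ((2:ℝ)^l)^2 * δ *
        ∫ t in Set.Icc (a - ((2:ℝ)^l)⁻¹ / 2) (a + 2 * δ + ((2:ℝ)^l)⁻¹ / 2), ‖f t‖ := by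
  set J := Set.Icc (a - ((2:ℝ)^l)⁻¹ / 2) (a + 2 * δ + ((2:ℝ)^l)⁻¹ / 2) with hJ
  have hψl := continuous_psiDil hψ l
  have hint : ∀ z : ℝ, Integrable fun t => psiDil ψ l (z - t) * f t := fun z => by
    refine Continuous.integrable_of_hasCompactSupport (by fun_prop) ?_
    exact ((hasCompactSupport_psiDil hsupp l).comp_homeomorph (Homeomorph.subLeft z)).mul_right
  have hzero : ∀ z ∈ Set.Icc a (a + 2 * δ), ∀ t ∉ J, psiDil ψ l (z - t) = 0 := by
    intro z hz t ht
    refine psiDil_eq_zero hsupp l ?_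
    by_contra! h
    rw [abs_le] at h
    exact ht ⟨by linarith [hz.1], by linarith [hz.2]⟩
  rw [conv_eq_integral_sub_left, conv_eq_integral_sub_left, ← integral_sub (hint _) (hint _),
    ← setIntegral_eq_integral_of_forall_compl_eq_zero (s := J), ← integral_const_mul]
  · refine norm_integral_le_of_norm_le ?_ (Filter.Eventually.of_forall fun t => ?_)
    · exact (continuous_const.mul hf.norm).continuousOn.integrableOn_Icc
    · rw [← sub_mul, norm_mul]
      gcongr
      refine (norm_psiDil_sub_le hL l _ _).trans_eq ?_
      rw [show y - t - (y + δ - t) = -δ by ring, abs_neg, abs_of_nonneg hδ]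
  · intro t ht
    rw [hzero y ⟨hy.1, by linarith [hy.2]⟩ t ht,
      hzero (y + δ) ⟨by linarith [hy.1], by linarith [hy.2]⟩ t ht]
    simp

theorem norm_pairing_le {ψ : ℝ → ℂ} {L : ℝ} (hψ : Continuous ψ)
    (hL : ∀ x y, ‖ψ x - ψ y‖ ≤ L * |x - y|)
    (hsupp : Function.support ψ ⊆ Set.Icc (-(1/2) : ℝ) (1/2)) (l j : ℕ) (μ : ℤ)
    {f : ℝ → ℂ} (hf : Continuous f) (a d : ℝ) (hd : d = (2:ℝ)^(-(j:ℤ))) (ha : a = d * μ) :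
    ‖∫ y, conv (psiDil ψ l) f y * haarFn j μ y‖ ≤
      L * ((2:ℝ)^l)^2 * (d / 2)^2 *
        ∫ t in Set.Icc (a - ((2:ℝ)^l)⁻¹ / 2) (a + d + ((2:ℝ)^l)⁻¹ / 2), ‖f t‖ := by
  have hd0 : 0 < d := by rw [hd]; positivity
  refine (norm_integral_mul_haarFn_le (continuous_conv (hasCompactSupport_psiDil hsupp l)
    (continuous_psiDil hψ l) hf) j μ a d _ hd ha fun y hy =>
      norm_conv_psiDil_sub_le hψ hL hsupp l hf a (d / 2) (by linarith) hy).trans_eq ?_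
  rw [mul_div_cancel₀ d two_ne_zero]
  ring

theorem norm_conv_psiDil_haarFn_le_of_lipschitz {ψ : ℝ → ℂ} {L : ℝ} (hψ : Continuous ψ)
    (hL : ∀ x y, ‖ψ x - ψ y‖ ≤ L * |x - y|) (k j : ℕ) (μ : ℤ) (x d : ℝ)
    (hd : d = (2:ℝ)^(-(j:ℤ))) :
    ‖conv (psiDil ψ k) (haarFn j μ) x‖ ≤ L * ((2:ℝ)^k)^2 * (d / 2)^2 := by
  have hd0 : 0 < d := by rw [hd]; positivity
  have hc := continuous_psiDil hψ k
  rw [conv_eq_integral_sub_left]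
  refine (norm_integral_mul_haarFn_le (g := fun t => psiDil ψ k (x - t)) (by fun_prop) j μ _ d
    (L * ((2:ℝ)^k)^2 * (d / 2)) hd rfl fun y _ => ?_).trans_eq (by ring)
  refine (norm_psiDil_sub_le hL k _ _).trans_eq ?_
  rw [show x - y - (x - (y + d / 2)) = d / 2 by ring, abs_of_nonneg (by linarith)]

theorem norm_conv_psiDil_haarFn_le_of_bound {ψ : ℝ → ℂ} {A : ℝ}
    (hA : ∀ x, ‖ψ x‖ ≤ A) (hsupp : Function.support ψ ⊆ Set.Icc (-(1/2) : ℝ) (1/2))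
    (k j : ℕ) (μ : ℤ) (x : ℝ) :
    ‖conv (psiDil ψ k) (haarFn j μ) x‖ ≤ A := by
  have h2 : (0:ℝ) < 2^k := by positivity
  rw [conv, ← setIntegral_eq_integral_of_forall_compl_eq_zero
    (s := Set.Icc (-(((2:ℝ)^k)⁻¹ / 2)) (((2:ℝ)^k)⁻¹ / 2))]
  · refine (norm_setIntegral_le_of_norm_le_const (C := 2^k * A) measure_Icc_lt_top
      fun t _ => ?_).trans_eq ?_
    · rw [norm_mul, psiDil, norm_mul, norm_pow, Complex.norm_ofNat]
      refine (mul_le_of_le_one_right (by positivity) (norm_haarFn_le_one _ _ _)).trans ?_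
      gcongr
      exact hA _
    · rw [Real.volume_real_Icc_of_le (by linarith [inv_pos.2 h2] :
        -(((2:ℝ)^k)⁻¹ / 2) ≤ ((2:ℝ)^k)⁻¹ / 2)]
      field_simp
      ring
  · intro t ht
    rw [psiDil_eq_zero hsupp k, zero_mul]
    by_contra! h
    exact ht (abs_le.1 h)

theorem conv_psiDil_haarFn_eq_zero {ψ : ℝ → ℂ}
    (hsupp : Function.support ψ ⊆ Set.Icc (-(1/2) : ℝ) (1/2)) (k j : ℕ) (μ : ℤ) (x d : ℝ)
    (hd : d = (2:ℝ)^(-(j:ℤ)))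
    (h : ¬ (d * μ ≤ x + ((2:ℝ)^k)⁻¹ / 2 ∧ x - ((2:ℝ)^k)⁻¹ / 2 ≤ d * μ + d)) :
    conv (psiDil ψ k) (haarFn j μ) x = 0 := by
  rw [conv]
  refine integral_eq_zero_of_ae (Filter.Eventually.of_forall fun t => ?_)
  by_cases ht : ((2:ℝ)^k)⁻¹ / 2 < |t|
  · simp [psiDil_eq_zero hsupp k ht]
  · have hh : haarFn j μ (x - t) = 0 := by
      apply haarFn_eq_zero
      rw [← hd]
      rw [not_lt, abs_le] at ht
      by_contra! hc
      exact h ⟨by linarith [hc.1, ht.1], by linarith [hc.2, ht.2]⟩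
    simp [hh]

theorem card_filter_dyadic_le (F : Finset ℤ) (x e d : ℝ) (hd : 0 < d) (he : 0 ≤ e) :
    ((F.filter fun μ : ℤ => d * μ ≤ x + e / 2 ∧ x - e / 2 ≤ d * μ + d).card : ℝ) ≤ e / d + 2 := by
  have hsub : (F.filter fun μ : ℤ => d * μ ≤ x + e / 2 ∧ x - e / 2 ≤ d * μ + d) ⊆
      Finset.Icc ⌈(x - e / 2) / d - 1⌉ ⌊(x + e / 2) / d⌋ := by
    intro μ hμ
    obtain ⟨-, h₁, h₂⟩ := Finset.mem_filter.1 hμ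
    rw [Finset.mem_Icc, Int.ceil_le, Int.le_floor, le_div_iff₀ hd, sub_le_iff_le_add,
      div_le_iff₀ hd]
    constructor <;> linarith
  refine (Nat.cast_le.2 (Finset.card_le_card hsub)).trans ?_
  rw [Int.card_Icc]
  have h₁ := Int.floor_le ((x + e / 2) / d)
  have h₂ := Int.le_ceil ((x - e / 2) / d - 1)
  have hed : 0 ≤ e / d := by positivity
  have hdiff : (x + e / 2) / d - (x - e / 2) / d = e / d := by ring
  have hcast : (((⌊(x + e / 2) / d⌋ + 1 - ⌈(x - e / 2) / d - 1⌉).toNat : ℤ) : ℝ) =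
      ((max (⌊(x + e / 2) / d⌋ + 1 - ⌈(x - e / 2) / d - 1⌉) 0 : ℤ) : ℝ) := by
    rw [Int.toNat_eq_max]
  rw [← Int.cast_natCast, hcast]
  push_cast
  exact max_le (by linarith) (by linarith)

/-- Only `O(2 ^ (j - k) + 1)` Haar functions contribute at `x`; given bounds `S` for the local mass
of `f` and `Q` for the smoothed Haar functions, the terms add up as follows. -/
theorem norm_TOp_le {ψ : ℝ → ℂ} {L : ℝ} (hψ : Continuous ψ) (hL0 : 0 ≤ L)
    (hL : ∀ x y, ‖ψ x - ψ y‖ ≤ L * |x - y|)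
    (hsupp : Function.support ψ ⊆ Set.Icc (-(1/2) : ℝ) (1/2)) (k j l : ℕ) (F : Finset ℤ)
    {f : ℝ → ℂ} (hf : Continuous f) (x S Q : ℝ) (hS0 : 0 ≤ S)
    (hS : ∀ a : ℝ, a ≤ x + ((2:ℝ)^k)⁻¹ / 2 → x - ((2:ℝ)^k)⁻¹ / 2 ≤ a + ((2:ℝ)^j)⁻¹ →
      ∫ t in Set.Icc (a - ((2:ℝ)^l)⁻¹ / 2) (a + ((2:ℝ)^j)⁻¹ + ((2:ℝ)^l)⁻¹ / 2), ‖f t‖ ≤ S)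
    (hQ : ∀ μ : ℤ, ‖conv (psiDil ψ k) (haarFn j μ) x‖ ≤ Q) :
    ‖TOp ψ k ((j:ℤ) - k) ((l:ℤ) - j) F f x‖ ≤
      ((2:ℝ)^j / (2:ℝ)^k + 2) * (L * ((2:ℝ)^l)^2 / (4 * (2:ℝ)^j) * S * Q) := by
  have hk : (0:ℝ) < 2^k := by positivity
  have hj : (0:ℝ) < 2^j := by positivity
  have hQ0 : 0 ≤ Q := (norm_nonneg _).trans (hQ 0)
  have e₁ : ((k:ℤ) + ((j:ℤ) - k)).toNat = j := by rw [add_sub_cancel, Int.toNat_natCast]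
  have e₂ : ((k:ℤ) + ((j:ℤ) - k) + ((l:ℤ) - j)).toNat = l := by
    rw [add_sub_cancel, add_sub_cancel, Int.toNat_natCast]
  have hd : ((2:ℝ)^j)⁻¹ = (2:ℝ)^(-(j:ℤ)) := by rw [zpow_neg, zpow_natCast]
  rw [TOp, e₁, e₂]
  set p : ℤ → Prop := fun μ => ((2:ℝ)^j)⁻¹ * μ ≤ x + ((2:ℝ)^k)⁻¹ / 2 ∧
    x - ((2:ℝ)^k)⁻¹ / 2 ≤ ((2:ℝ)^j)⁻¹ * μ + ((2:ℝ)^j)⁻¹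
  rw [← Finset.sum_filter_of_ne (p := p)]
  · have hterm : ∀ μ ∈ F.filter p, ‖(2:ℂ)^j *
        (∫ y : ℝ, conv (psiDil ψ l) f y * haarFn j μ y) * conv (psiDil ψ k) (haarFn j μ) x‖ ≤
        L * ((2:ℝ)^l)^2 / (4 * (2:ℝ)^j) * S * Q := by
      intro μ hμ
      obtain ⟨-, h₁, h₂⟩ := Finset.mem_filter.1 hμ
      rw [norm_mul, norm_mul, norm_pow, Complex.norm_ofNat]
      have hpair := (norm_pairing_le hψ hL hsupp l j μ hf _ _ hd rfl).trans
        (mul_le_mul_of_nonneg_left (hS _ h₁ h₂) (by positivity))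
      calc _ ≤ (2:ℝ)^j * (L * ((2:ℝ)^l)^2 * (((2:ℝ)^j)⁻¹ / 2)^2 * S) * Q := by
            gcongr
            exact hQ μ
        _ = _ := by field_simp; ring
    refine (norm_sum_le_of_le _ hterm).trans ?_
    rw [Finset.sum_const, nsmul_eq_mul]
    refine mul_le_mul_of_nonneg_right ?_ (by positivity)
    refine (card_filter_dyadic_le F x ((2:ℝ)^k)⁻¹ ((2:ℝ)^j)⁻¹ (by positivity)
      (by positivity)).trans_eq ?_
    field_simp
  · intro μ _ hne
    by_contra hn
    exact hne (by rw [conv_psiDil_haarFn_eq_zero hsupp k j μ x _ hd hn, mul_zero])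

theorem bddAbove_hlMax {f : ℝ → ℂ} {B : ℝ} (hB : ∀ x, ‖f x‖ ≤ B) (x : ℝ) :
    BddAbove {t : ℝ | ∃ r : ℝ, 0 < r ∧ t = (2*r)⁻¹ * ∫ y in Set.Icc (x - r) (x + r), ‖f y‖} := by
  refine ⟨B, ?_⟩
  rintro _ ⟨r, hr, rfl⟩
  have h := norm_setIntegral_le_of_norm_le_const (μ := volume) (s := Set.Icc (x - r) (x + r))
    (f := fun y => ‖f y‖) (C := B) (by simp) fun y _ => by simpa using hB y
  rw [Real.volume_real_Icc_of_le (by linarith)] at h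
  have h' := (le_abs_self _).trans h
  rw [inv_mul_le_iff₀ (by linarith)]
  linarith

theorem integral_le_hlMax {f : ℝ → ℂ} {B : ℝ} (hB : ∀ x, ‖f x‖ ≤ B) (x : ℝ) {r : ℝ} (hr : 0 < r) :
    ∫ y in Set.Icc (x - r) (x + r), ‖f y‖ ≤ 2 * r * hlMax f x := by
  have h : _ ≤ hlMax f x := le_csSup (bddAbove_hlMax hB x) ⟨r, hr, rfl⟩
  rwa [inv_mul_le_iff₀ (by linarith)] at h

theorem hlMax_nonneg (f : ℝ → ℂ) (x : ℝ) : 0 ≤ hlMax f x := by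
  refine Real.sSup_nonneg ?_
  rintro _ ⟨r, hr, rfl⟩
  positivity

theorem norm_le_ballSup {f : ℝ → ℂ} {B : ℝ} (hB : ∀ x, ‖f x‖ ≤ B) {c x t : ℝ}
    (ht : |t - x| ≤ c) : ‖f t‖ ≤ ballSup c f x := by
  refine le_csSup ⟨B, ?_⟩ ⟨t - x, ht, by rw [add_sub_cancel]⟩
  rintro _ ⟨y, -, rfl⟩
  exact hB _

theorem ballSup_nonneg (c : ℝ) (f : ℝ → ℂ) (x : ℝ) : 0 ≤ ballSup c f x := by
  refine Real.sSup_nonneg ?_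
  rintro _ ⟨y, -, rfl⟩
  positivity

/-- Pointwise bounds for $T^k_{m,n}$, cases $n\le0$. -/
theorem TOp_pointwise_bound_n_nonpos
    (ψ : ℝ → ℂ) (hψsmooth : ContDiff ℝ (⊤ : ℕ∞) ψ)
    (hψsupp : Function.support ψ ⊆ Set.Icc (-(1/2) : ℝ) (1/2))
    (hψcanc : ∫ x : ℝ, ψ x = 0) :
    ∃ C : ℝ, 0 < C ∧ ∀ (k : ℕ) (m n : ℤ), 0 ≤ (k:ℤ) + m → 0 ≤ (k:ℤ) + m + n →
      ∀ (F : Finset ℤ) (f : ℝ → ℂ), Continuous f → (∃ B : ℝ, ∀ x, ‖f x‖ ≤ B) →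
      (0 ≤ m → -m ≤ n → n ≤ 0 → ∀ x : ℝ,
        ‖TOp ψ k m n F f x‖ ≤ C * (2:ℝ)^(n-m) * ballSup ((2:ℝ)^(2-(k:ℤ))) f x) ∧
      (0 ≤ m → n < -m → ∀ x : ℝ,
        ‖TOp ψ k m n F f x‖ ≤ C * (2:ℝ)^(n-m) * hlMax f x) ∧
      (m ≤ 0 → n ≤ 0 → ∀ x : ℝ,
        ‖TOp ψ k m n F f x‖ ≤ C * hlMax f x) := by
  have hψ := hψsmooth.continuous
  have hcs : HasCompactSupport ψ := HasCompactSupport.intro isCompact_Icc fun x hx => by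
    by_contra hne
    exact hx (hψsupp hne)
  obtain ⟨A, hA⟩ := hψ.bounded_above_of_compact_support hcs
  obtain ⟨L, hLip⟩ := hψsmooth.lipschitzWith_of_hasCompactSupport hcs (by simp)
  have hL : ∀ x y, ‖ψ x - ψ y‖ ≤ L * |x - y| := fun x y => by
    simpa [dist_eq_norm] using hLip.dist_le_mul x y
  have hL0 : (0:ℝ) ≤ L := L.2
  have hA0 : 0 ≤ A := (norm_nonneg _).trans (hA 0)
  refine ⟨3 * (L:ℝ)^2 + 3 * L * A + 1, by positivity, ?_⟩
  intro k m n hkm hkmn F f hf ⟨B, hB⟩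
  obtain ⟨j, hj⟩ := Int.eq_ofNat_of_zero_le hkm
  obtain ⟨l, hl⟩ := Int.eq_ofNat_of_zero_le hkmn
  obtain rfl : m = (j:ℤ) - k := by omega
  obtain rfl : n = (l:ℤ) - j := by omega
  set u : ℝ := (2:ℝ)^k with hu
  set v : ℝ := (2:ℝ)^j with hv
  set w : ℝ := (2:ℝ)^l with hw
  have hu0 : 0 < u := by positivity
  have hv0 : 0 < v := by positivity
  have hw0 : 0 < w := by positivity
  have hexp : (2:ℝ)^((l:ℤ) - j - ((j:ℤ) - k)) = w * u / v^2 := by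
    rw [zpow_sub₀ two_ne_zero, zpow_sub₀ two_ne_zero, zpow_sub₀ two_ne_zero, zpow_natCast,
      zpow_natCast, zpow_natCast, ← hu, ← hv, ← hw]
    field_simp
  have hpow : ∀ {p q : ℕ}, p ≤ q → (2:ℝ)^p ≤ (2:ℝ)^q := fun h =>
    pow_le_pow_right₀ one_le_two h
  have hinv : ∀ {p q : ℕ}, p ≤ q → ((2:ℝ)^q)⁻¹ ≤ ((2:ℝ)^p)⁻¹ := fun h =>
    inv_anti₀ (by positivity) (hpow h)
  have hloc : ∀ {x : ℝ}, l ≤ j → l ≤ k → ∀ a : ℝ, a ≤ x + u⁻¹ / 2 → x - u⁻¹ / 2 ≤ a + v⁻¹ →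
      ∫ t in Set.Icc (a - w⁻¹ / 2) (a + v⁻¹ + w⁻¹ / 2), ‖f t‖ ≤ 4 / w * hlMax f x := by
    intro x hlj hlk a h₁ h₂
    have hvw : v⁻¹ ≤ w⁻¹ := hinv hlj
    have huw : u⁻¹ ≤ w⁻¹ := hinv hlk
    refine (setIntegral_mono_set (t := Set.Icc (x - 2 * w⁻¹) (x + 2 * w⁻¹))
      hf.norm.continuousOn.integrableOn_Icc (Filter.Eventually.of_forall fun t => norm_nonneg _)
      (Set.Icc_subset_Icc (by linarith) (by linarith)).eventuallyLE).trans ?_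
    refine (integral_le_hlMax hB x (by positivity)).trans_eq ?_
    field_simp
    ring
  have hcoarse : k ≤ j → v / u + 2 ≤ 3 * (v / u) := fun hkj => by
    have : 1 ≤ v / u := (one_le_div hu0).2 (hpow hkj)
    linarith
  have hM := hlMax_nonneg f
  refine ⟨fun hm hn hn' x => ?_, fun hm hn x => ?_, fun hm hn x => ?_⟩
  · have hkj : k ≤ j := by omega
    have hkl : k ≤ l := by omega
    have hlj : l ≤ j := by omega
    have hS0 := ballSup_nonneg ((2:ℝ)^(2-(k:ℤ))) f x
    have hrad : (2:ℝ)^(2-(k:ℤ)) = 4 * u⁻¹ := by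
      rw [zpow_sub₀ two_ne_zero, zpow_natCast, div_eq_mul_inv, ← hu]
      norm_num
    have hvw : v⁻¹ ≤ w⁻¹ := hinv hlj
    have hwu : w⁻¹ ≤ u⁻¹ := hinv hkl
    have hw' : 0 < w⁻¹ := by positivity
    have hv' : 0 < v⁻¹ := by positivity
    refine (norm_TOp_le hψ hL0 hL hψsupp k j l F hf x (2 / w * ballSup ((2:ℝ)^(2-(k:ℤ))) f x)
      (L * u^2 * (v⁻¹ / 2)^2) (by positivity) (fun a h₁ h₂ => ?_) (fun μ =>
        norm_conv_psiDil_haarFn_le_of_lipschitz hψ hL k j μ x _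
          (by rw [zpow_neg, zpow_natCast]))).trans ?_
    · have h := norm_setIntegral_le_of_norm_le_const (μ := volume)
        (s := Set.Icc (a - w⁻¹ / 2) (a + v⁻¹ + w⁻¹ / 2)) (f := fun y => ‖f y‖)
        (C := ballSup ((2:ℝ)^(2-(k:ℤ))) f x) (by simp) fun t ht => by
          rw [norm_norm]
          refine norm_le_ballSup hB ?_
          rw [hrad, abs_le]
          constructor <;> linarith [ht.1, ht.2]
      refine ((le_abs_self _).trans h).trans ?_
      rw [Real.volume_real_Icc_of_le (by linarith), mul_comm]
      refine mul_le_mul_of_nonneg_right ?_ hS0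
      rw [div_eq_mul_inv 2 w]
      linarith
    · rw [hexp]
      refine (mul_le_mul_of_nonneg_right (hcoarse hkj) (by positivity)).trans ?_
      calc _ = (3 / 8 * (L:ℝ)^2) * (w * u / v^2) * ballSup ((2:ℝ)^(2-(k:ℤ))) f x := by
            simp only [← hv, ← hw]
            field_simp
            ring
        _ ≤ _ := by
            gcongr
            nlinarith [mul_nonneg hL0 hA0, sq_nonneg (L:ℝ)]
  · have hkj : k ≤ j := by omega
    have hM' := hM x
    refine (norm_TOp_le hψ hL0 hL hψsupp k j l F hf x (4 / w * hlMax f x)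
      (L * u^2 * (v⁻¹ / 2)^2) (by positivity) (hloc (by omega) (by omega)) (fun μ =>
        norm_conv_psiDil_haarFn_le_of_lipschitz hψ hL k j μ x _
          (by rw [zpow_neg, zpow_natCast]))).trans ?_
    rw [hexp]
    refine (mul_le_mul_of_nonneg_right (hcoarse hkj) (by positivity)).trans ?_
    calc _ = (3 / 4 * (L:ℝ)^2) * (w * u / v^2) * hlMax f x := by
          simp only [← hv, ← hw]
          field_simp
          ring
      _ ≤ _ := by
          gcongr
          nlinarith [mul_nonneg hL0 hA0, sq_nonneg (L:ℝ)]
  · have hM' := hM x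
    have hvu : v / u ≤ 1 := (div_le_one hu0).2 (hpow (by omega))
    have hwv : w / v ≤ 1 := (div_le_one hv0).2 (hpow (by omega))
    refine (norm_TOp_le hψ hL0 hL hψsupp k j l F hf x (4 / w * hlMax f x) A (by positivity)
      (hloc (by omega) (by omega)) (fun μ =>
        norm_conv_psiDil_haarFn_le_of_bound hA hψsupp k j μ x)).trans ?_
    calc _ ≤ 3 * (L * w^2 / (4 * v) * (4 / w * hlMax f x) * A) := by
          refine mul_le_mul_of_nonneg_right ?_ (by positivity)
          linarith
      _ = 3 * L * A * hlMax f x * (w / v) := by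
          field_simp
      _ ≤ 3 * L * A * hlMax f x := mul_le_of_le_one_right (by positivity) hwv
      _ ≤ _ := by
          gcongr
          nlinarith [sq_nonneg (L:ℝ)]
end
end

section
/- Let 1 ≤ q ≤ p < ∞, let M₀ ≥ 0 be an integer, and let s be a real number with s > −M₀. Let η : ℝ → ℂ be a smooth function supported in (−1/2, 1/2) with ∫_ℝ η(x) x^n dx = 0 for all integers 0 ≤ n ≤ M₀. There exists a constant C (depending only on p, q, s, M₀, η and φ₀) with the following property. Let m ≥ 0 be an integer, let L be a finite set of integers with l ≥ m for every l ∈ L and #L ≥ 2^m, for each l ∈ L let P_l be a finite subset of [0,1] such that any two distinct points of P_l differ by at least 2^{m−l}, and let a_{l,x} ∈ ℂ with |a_{l,x}| ≤ 1 for all l ∈ L, x ∈ P_l. Define g = ∑_{l∈L} 2^{−ls} ∑_{x∈P_l} a_{l,x} · η(2^l(· − x)). Then ‖g‖_{F^s_{p,q}} ≤ C · (2^{−m} · #L)^{1/q}. -/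
open MeasureTheory Real FourierTransform
open scoped ENNReal

noncomputable section

def haarProj (E : Finset (ℕ × ℤ)) (f : ℝ → ℂ) : ℝ → ℂ := fun x =>
  ∑ e ∈ E, (2:ℂ)^e.1 * (∫ y : ℝ, f y * haarFn e.1 e.2 y) * haarFn e.1 e.2 x

def HFset (E : Finset (ℕ × ℤ)) : Finset ℕ := E.image Prod.fst

def LPop (φ₀ : ℝ → ℂ) (k : ℕ) (g : ℝ → ℂ) : ℝ → ℂ :=
  if k = 0 then conv g (𝓕⁻ φ₀)
  else conv g (fun x => (2:ℂ)^k * (𝓕⁻ (fun ξ => φ₀ ξ - φ₀ (2*ξ))) ((2:ℝ)^k * x))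

def FNorm (φ₀ : ℝ → ℂ) (p q s : ℝ) (g : ℝ → ℂ) : ℝ≥0∞ :=
  (∫⁻ x : ℝ, (∑' k : ℕ, ENNReal.ofReal ((2:ℝ)^((k:ℝ)*s*q)) *
      (ENNReal.ofReal ‖LPop φ₀ k g x‖)^q)^(p/q) ∂volume)^(1/p)

/-- The rescaled polynomial bump `(1 + u |y - x|)⁻²` centred at `x`. -/
def bump (u x y : ℝ) : ℝ := ((1 + u * |y - x|) ^ 2)⁻¹

/-- The integral of the unit bump. -/
def bumpMass : ℝ := ∫ y : ℝ, bump 1 0 y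

lemma bump_pos {u : ℝ} (hu : 0 < u) (x y : ℝ) : 0 < bump u x y := by
  unfold bump; positivity

lemma bump_comm (u x y : ℝ) : bump u x y = bump u y x := by
  unfold bump; rw [abs_sub_comm]

lemma bump_le_one {u : ℝ} (hu : 0 < u) (x y : ℝ) : bump u x y ≤ 1 := by
  unfold bump
  apply inv_le_one_of_one_le₀
  have : 0 ≤ u * |y - x| := by positivity
  nlinarith

lemma continuous_bump {u : ℝ} (hu : 0 < u) (x : ℝ) : Continuous (bump u x) := by
  unfold bump
  refine Continuous.inv₀ (by fun_prop) fun y => ?_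
  positivity

lemma bump_eq_unit {u : ℝ} (hu : 0 < u) (x y : ℝ) : bump u x y = bump 1 0 (u * (y - x)) := by
  simp [bump, abs_mul, abs_of_pos hu]

lemma integrable_bump_unit : Integrable (bump 1 0) := by
  have h := integrable_one_add_norm (E := ℝ) (μ := volume) (r := 2) (by simp)
  refine h.congr (Filter.Eventually.of_forall fun y => ?_)
  have : (0:ℝ) ≤ 1 + ‖y‖ := by positivity
  simp only [bump, Real.rpow_neg this]
  norm_num

lemma integrable_bump {u : ℝ} (hu : 0 < u) (x : ℝ) : Integrable (bump u x) := by
  have h1 : Integrable (fun y => bump 1 0 (u * y)) :=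
    (integrable_comp_mul_left_iff (bump 1 0) hu.ne').2 integrable_bump_unit
  refine (h1.comp_sub_right x).congr (Filter.Eventually.of_forall fun y => ?_)
  exact (bump_eq_unit hu x y).symm

lemma integral_bump {u : ℝ} (hu : 0 < u) (x : ℝ) : ∫ y, bump u x y = bumpMass / u := by
  simp_rw [bump_eq_unit hu x]
  rw [integral_sub_right_eq_self (fun y => bump 1 0 (u * y)) x,
    Measure.integral_comp_mul_left (bump 1 0) u, abs_of_pos (by positivity), bumpMass, smul_eq_mul]
  ring

lemma bumpMass_nonneg : 0 ≤ bumpMass :=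
  integral_nonneg fun y => (bump_pos one_pos 0 y).le

/-- The product of a coarse and a fine bump is controlled by the separation of their centres. -/
lemma bump_mul_bump_le {u v : ℝ} (hu : 0 < u) (huv : u ≤ v) (x x' y : ℝ) :
    bump u x y * bump v x' y ≤
      4 * bump u x x' * (bump v x' y + (u / v) ^ 2 * bump u x y) := by
  have hv : 0 < v := hu.trans_le huv
  have b1 := bump_pos hu x y
  have b2 := bump_pos hv x' y
  have b3 := bump_pos hu x x'
  rcases le_total ((1 + u * |x' - x|) / 2) (1 + u * |y - x|) with h | h
  · have : bump u x y ≤ 4 * bump u x x' := by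
      unfold bump
      rw [show 4 * ((1 + u * |x' - x|) ^ 2)⁻¹ = (((1 + u * |x' - x|) / 2) ^ 2)⁻¹ by
        field_simp; norm_num]
      gcongr
    calc bump u x y * bump v x' y ≤ 4 * bump u x x' * bump v x' y := by gcongr
      _ ≤ _ := by
        gcongr
        have : 0 ≤ (u / v) ^ 2 * bump u x y := by positivity
        linarith
  · have tri : |x' - x| ≤ |y - x'| + |y - x| := by
      have := abs_sub_le x' y x
      rwa [abs_sub_comm x' y] at this
    have h2 : (1 + u * |x' - x|) / 2 ≤ u * |y - x'| := by nlinarith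
    have h3 : v / u * ((1 + u * |x' - x|) / 2) ≤ 1 + v * |y - x'| := by
      calc v / u * ((1 + u * |x' - x|) / 2) ≤ v / u * (u * |y - x'|) := by gcongr
        _ = v * |y - x'| := by field_simp
        _ ≤ _ := by linarith
    have : bump v x' y ≤ 4 * bump u x x' * (u / v) ^ 2 := by
      unfold bump
      rw [show 4 * ((1 + u * |x' - x|) ^ 2)⁻¹ * (u / v) ^ 2
          = ((v / u * ((1 + u * |x' - x|) / 2)) ^ 2)⁻¹ by field_simp; norm_num]
      gcongr
    calc bump u x y * bump v x' y ≤ bump u x y * (4 * bump u x x' * (u / v) ^ 2) := by gcongr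
      _ = 4 * bump u x x' * ((u / v) ^ 2 * bump u x y) := by ring
      _ ≤ _ := by
        gcongr
        linarith

/-- Sums of bumps over separated points. -/
lemma sum_bump_le {u d : ℝ} (hu : 0 < u) (hd : 0 < d) (Q : Finset ℝ)
    (hQ : ∀ x ∈ Q, ∀ y ∈ Q, x ≠ y → d ≤ |x - y|) (x : ℝ) :
    ∑ x' ∈ Q, bump u x x' ≤ 4 * bumpMass * (1 + 1 / (u * d)) := by
  set e := min d (1 / u) with he
  have he0 : 0 < e := by positivity
  have heu : u * e ≤ 1 := by
    calc u * e ≤ u * (1 / u) := by gcongr; exact min_le_right _ _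
      _ = 1 := by field_simp
  have key : ∀ x' ∈ Q, e * bump u x x' ≤ 4 * ∫ z in Set.Ico x' (x' + e), bump u x z := by
    intro x' _
    have h1 : ∫ z in Set.Ico x' (x' + e), bump u x x' / 4 ≤
        ∫ z in Set.Ico x' (x' + e), bump u x z := by
      refine setIntegral_mono_on ?_ (integrable_bump hu x).integrableOn measurableSet_Ico ?_
      · exact integrableOn_const (by simp)
      · intro z hz
        unfold bump
        have hz1 : |z - x| ≤ |x' - x| + e := by
          have := abs_sub_le z x' x
          have h2 : |z - x'| ≤ e := by
            rw [abs_le]; constructor <;> linarith [hz.1, hz.2]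
          linarith
        have hz2 : 1 + u * |z - x| ≤ 2 * (1 + u * |x' - x|) := by
          nlinarith [abs_nonneg (x' - x), mul_nonneg hu.le (abs_nonneg (x' - x))]
        rw [show ((1 + u * |x' - x|) ^ 2)⁻¹ / 4 = ((2 * (1 + u * |x' - x|)) ^ 2)⁻¹ by
          field_simp; norm_num]
        gcongr
    rw [setIntegral_const, smul_eq_mul, Measure.real, Real.volume_Ico] at h1
    rw [ENNReal.toReal_ofReal (by linarith)] at h1
    linarith
  have hdisj : (Q : Set ℝ).Pairwise (Function.onFun Disjoint fun x' => Set.Ico x' (x' + e)) := by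
    intro a ha b hb hab
    have h := (min_le_left d (1 / u)).trans (hQ a ha b hb hab)
    rw [← he] at h
    refine Set.disjoint_left.2 fun z hz1 hz2 => ?_
    rcases abs_cases (a - b) with h' | h' <;> linarith [hz1.1, hz1.2, hz2.1, hz2.2]
  have hsum : e * ∑ x' ∈ Q, bump u x x' ≤ 4 * (bumpMass / u) := by
    rw [Finset.mul_sum]
    calc ∑ x' ∈ Q, e * bump u x x' ≤ ∑ x' ∈ Q, 4 * ∫ z in Set.Ico x' (x' + e), bump u x z :=
          Finset.sum_le_sum key
      _ = 4 * ∫ z in ⋃ x' ∈ Q, Set.Ico x' (x' + e), bump u x z := by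
          rw [← Finset.mul_sum, integral_biUnion_finset Q (fun _ _ => measurableSet_Ico) hdisj
            fun _ _ => (integrable_bump hu x).integrableOn]
      _ ≤ 4 * ∫ z, bump u x z := by
          refine mul_le_mul_of_nonneg_left ?_ (by norm_num)
          exact setIntegral_le_integral (integrable_bump hu x)
            (Filter.Eventually.of_forall fun z => (bump_pos hu x z).le)
      _ = _ := by rw [integral_bump hu]
  have hinv : 1 / (u * e) ≤ 1 + 1 / (u * d) := by
    rcases min_choice d (1 / u) with h | h
    · rw [he, h]; linarith
    · rw [he, h]
      have : 0 < 1 / (u * d) := by positivity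
      have h1 : u * (1 / u) = 1 := by field_simp
      rw [h1]; linarith
  have h4 : 0 ≤ 4 * bumpMass := by linarith [bumpMass_nonneg]
  calc ∑ x' ∈ Q, bump u x x' = e * (∑ x' ∈ Q, bump u x x') / e := by field_simp
    _ ≤ 4 * (bumpMass / u) / e := by gcongr
    _ = 4 * bumpMass * (1 / (u * e)) := by field_simp
    _ ≤ _ := by gcongr

/-- Two-sided geometric decay `2 ^ (-δ |j|)`. -/
def expDecay (δ : ℝ) (j : ℤ) : ℝ := (2:ℝ) ^ (-(δ * |(j:ℝ)|))

lemma expDecay_pos (δ : ℝ) (j : ℤ) : 0 < expDecay δ j := by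
  unfold expDecay; positivity

lemma summable_expDecay {δ : ℝ} (hδ : 0 < δ) : Summable (expDecay δ) := by
  have hr : (2:ℝ) ^ (-δ) < 1 := Real.rpow_lt_one_of_one_lt_of_neg one_lt_two (by linarith)
  have hg : Summable fun n : ℕ => ((2:ℝ) ^ (-δ)) ^ n :=
    summable_geometric_of_lt_one (by positivity) hr
  have h : ∀ n : ℕ, ((2:ℝ) ^ (-δ)) ^ n = (2:ℝ) ^ (-(δ * n)) := fun n => by
    rw [← Real.rpow_natCast, ← Real.rpow_mul (by norm_num)]; ring_nf
  refine Summable.of_nat_of_neg (hg.congr fun n => ?_) (hg.congr fun n => ?_) <;>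
    rw [h] <;> simp [expDecay]

lemma sum_expDecay_le {δ : ℝ} (hδ : 0 < δ) (L : Finset ℤ) (a : ℤ) :
    ∑ l ∈ L, expDecay δ (a - l) ≤ ∑' j, expDecay δ j := by
  have hinj : Function.Injective fun l : ℤ => a - l := fun _ _ h => by simpa using h
  have := (summable_expDecay hδ).sum_le_tsum (L.map ⟨_, hinj⟩) fun j _ => (expDecay_pos δ j).le
  simpa using this

lemma tsum_expDecay_pos {δ : ℝ} (hδ : 0 < δ) : 0 < ∑' j, expDecay δ j :=
  (summable_expDecay hδ).tsum_pos (fun j => (expDecay_pos δ j).le) 0 (expDecay_pos δ 0)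

/-- The sum of bumps of width `2 ^ (-l)` centred at the points of `P l`, over `l ∈ L`. -/
def bumpSum (P : ℤ → Finset ℝ) (L : Finset ℤ) (y : ℝ) : ℝ :=
  ∑ l ∈ L, ∑ x ∈ P l, bump ((2:ℝ) ^ l) x y

lemma bumpSum_nonneg (P : ℤ → Finset ℝ) (L : Finset ℤ) (y : ℝ) : 0 ≤ bumpSum P L y :=
  Finset.sum_nonneg fun _ _ => Finset.sum_nonneg fun _ _ => (bump_pos (by positivity) _ _).le

lemma bumpSum_mono (P : ℤ → Finset ℝ) {L L' : Finset ℤ} (h : L ⊆ L') (y : ℝ) :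
    bumpSum P L y ≤ bumpSum P L' y :=
  Finset.sum_le_sum_of_subset_of_nonneg h fun _ _ _ =>
    Finset.sum_nonneg fun _ _ => (bump_pos (by positivity) _ _).le

lemma continuous_bumpSum (P : ℤ → Finset ℝ) (L : Finset ℤ) : Continuous (bumpSum P L) :=
  continuous_finsetSum _ fun _ _ => continuous_finsetSum _ fun _ _ =>
    continuous_bump (by positivity) _

lemma bumpSum_le_card (P : ℤ → Finset ℝ) (L : Finset ℤ) (y : ℝ) :
    bumpSum P L y ≤ ∑ l ∈ L, ((P l).card : ℝ) := by
  refine Finset.sum_le_sum fun l _ => ?_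
  calc ∑ x ∈ P l, bump ((2:ℝ) ^ l) x y ≤ ∑ x ∈ P l, (1:ℝ) :=
        Finset.sum_le_sum fun x _ => bump_le_one (by positivity) _ _
    _ = _ := by simp

lemma integrable_mul_bumpSum_pow (P : ℤ → Finset ℝ) (L : Finset ℤ) (n : ℕ) {f : ℝ → ℝ}
    (hf : Integrable f) : Integrable fun y => f y * bumpSum P L y ^ n := by
  refine hf.mul_bdd (c := (∑ l ∈ L, ((P l).card : ℝ)) ^ n)
    ((continuous_bumpSum P L).pow n).aestronglyMeasurable
    (Filter.Eventually.of_forall fun y => ?_)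
  rw [norm_pow, Real.norm_of_nonneg (bumpSum_nonneg P L y)]
  have := bumpSum_nonneg P L y
  gcongr
  exact bumpSum_le_card P L y

lemma integrable_bumpSum (P : ℤ → Finset ℝ) (L : Finset ℤ) : Integrable (bumpSum P L) :=
  integrable_finsetSum _ fun _ _ => integrable_finsetSum _ fun _ _ =>
    integrable_bump (by positivity) _

lemma add_pow_succ_le {a b : ℝ} (ha : 0 ≤ a) (hb : 0 ≤ b) (n : ℕ) :
    (a + b) ^ (n + 1) ≤ b ^ (n + 1) + (n + 1) * (a * (a + b) ^ n) := by
  induction n with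
  | zero => simp [add_comm]
  | succ n ih =>
    have hab : b * (a * (a + b) ^ n) ≤ a * (a + b) ^ (n + 1) := by
      rw [pow_succ]
      have : 0 ≤ a * (a + b) ^ n := by positivity
      nlinarith
    calc (a + b) ^ (n + 1 + 1) = a * (a + b) ^ (n + 1) + b * (a + b) ^ (n + 1) := by ring
      _ ≤ a * (a + b) ^ (n + 1) + b * (b ^ (n + 1) + (n + 1) * (a * (a + b) ^ n)) := by gcongr
      _ = b ^ (n + 1 + 1) + a * (a + b) ^ (n + 1) + (n + 1) * (b * (a * (a + b) ^ n)) := by ring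
      _ ≤ b ^ (n + 1 + 1) + a * (a + b) ^ (n + 1) + (n + 1) * (a * (a + b) ^ (n + 1)) := by gcongr
      _ = _ := by push_cast; ring

/-- Expansion of a power of a sum according to the smallest index. -/
lemma sum_pow_succ_le (w : ℤ → ℝ) (hw : ∀ l, 0 ≤ w l) (n : ℕ) (L : Finset ℤ) :
    (∑ l ∈ L, w l) ^ (n + 1) ≤
      (n + 1) * ∑ l ∈ L, w l * (∑ j ∈ L with l ≤ j, w j) ^ n := by
  induction L using Finset.induction_on_min with
  | empty => simp
  | insert a S ha ih =>
    have haS : a ∉ S := fun h => lt_irrefl _ (ha a h)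
    have h1 : (insert a S).filter (fun j => a ≤ j) = insert a S :=
      Finset.filter_true_of_mem fun j hj => by
        rcases Finset.mem_insert.1 hj with rfl | hj
        · exact le_rfl
        · exact (ha j hj).le
    have h2 : ∑ l ∈ S, w l * (∑ j ∈ insert a S with l ≤ j, w j) ^ n
        = ∑ l ∈ S, w l * (∑ j ∈ S with l ≤ j, w j) ^ n := by
      refine Finset.sum_congr rfl fun l hl => ?_
      rw [Finset.filter_insert, if_neg (not_le.2 (ha l hl))]
    rw [Finset.sum_insert haS, Finset.sum_insert haS, h1, h2, Finset.sum_insert haS]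
    have := add_pow_succ_le (hw a) (Finset.sum_nonneg fun l (_ : l ∈ S) => hw l) n
    linarith

lemma bumpSum_pow_succ_le (P : ℤ → Finset ℝ) (L : Finset ℤ) (n : ℕ) (y : ℝ) :
    bumpSum P L y ^ (n + 1) ≤ (n + 1) * ∑ l ∈ L, ∑ x ∈ P l,
      bump ((2:ℝ) ^ l) x y * bumpSum P (L.filter (l ≤ ·)) y ^ n := by
  have := sum_pow_succ_le (fun l => ∑ x ∈ P l, bump ((2:ℝ) ^ l) x y)
    (fun l => Finset.sum_nonneg fun _ _ => (bump_pos (by positivity) _ _).le) n L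
  simpa only [Finset.sum_mul, bumpSum] using this

/-- Points of `P l` are `2 ^ (m - l)`-separated, for all `l ∈ L`. -/
def Separated (m : ℕ) (P : ℤ → Finset ℝ) (L : Finset ℤ) : Prop :=
  ∀ l ∈ L, ∀ x ∈ P l, ∀ y ∈ P l, x ≠ y → (2:ℝ) ^ ((m:ℤ) - l) ≤ |x - y|

lemma Separated.subset {m : ℕ} {P : ℤ → Finset ℝ} {L L' : Finset ℤ} (h : Separated m P L)
    (hL : L' ⊆ L) : Separated m P L' := fun l hl => h l (hL hl)

/-- Localized moment bounds for the sum of bumps. -/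
lemma exists_integral_bump_mul_bumpSum_pow_le (n : ℕ) :
    ∃ C : ℝ, 0 ≤ C ∧ ∀ (m : ℕ) (P : ℤ → Finset ℝ) (L : Finset ℤ) (A : ℝ) (a : ℤ) (x : ℝ),
      Separated m P L → (∀ l ∈ L, a ≤ l) → 1 ≤ A → (2:ℝ) ^ (-(m:ℤ)) * L.card ≤ A →
      ∫ y, bump ((2:ℝ) ^ a) x y * bumpSum P L y ^ n ≤ C * (2:ℝ) ^ (-a) * A ^ n := by
  induction n with
  | zero =>
    refine ⟨bumpMass, bumpMass_nonneg, fun m P L A a x _ _ _ _ => ?_⟩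
    simp only [pow_zero, mul_one]
    rw [integral_bump (by positivity), zpow_neg, div_eq_mul_inv]
  | succ n ih =>
    obtain ⟨C, hC, ih⟩ := ih
    set S := ∑' j, expDecay 1 j
    have hS : 0 < S := tsum_expDecay_pos one_pos
    have hB := bumpMass_nonneg
    refine ⟨(n + 1) * (8 * C * (4 * bumpMass) * (S + 1)), by positivity, ?_⟩
    intro m P L A a x hsep hL hA hcard
    have hA0 : 0 ≤ A := by linarith
    set f : ℝ → ℝ := fun y => bump ((2:ℝ) ^ a) x y * bumpSum P L y ^ n with hf
    set F : ℤ → ℝ → ℝ → ℝ := fun l x' y =>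
      bump ((2:ℝ) ^ l) x' y * bumpSum P (L.filter (l ≤ ·)) y ^ n with hF
    have hfi : Integrable f :=
      integrable_mul_bumpSum_pow P L n (integrable_bump (by positivity) x)
    have hFi : ∀ l x', Integrable (F l x') := fun l x' =>
      integrable_mul_bumpSum_pow P _ n (integrable_bump (by positivity) x')
    set c : ℤ → ℝ → ℝ := fun _ x' => 4 * bump ((2:ℝ) ^ a) x x' with hc
    set r : ℤ → ℝ := fun l => ((2:ℝ) ^ a / (2:ℝ) ^ l) ^ 2 with hr
    have hc0 : ∀ l x', 0 ≤ c l x' := fun l x' => by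
      have := (bump_pos (u := (2:ℝ) ^ a) (by positivity) x x').le
      simp only [hc]; positivity
    have hpt : ∀ y, bump ((2:ℝ) ^ a) x y * bumpSum P L y ^ (n + 1) ≤
        (n + 1) * ∑ l ∈ L, ∑ x' ∈ P l, c l x' * (F l x' y + r l * f y) := by
      intro y
      have hb := (bump_pos (u := (2:ℝ) ^ a) (by positivity) x y).le
      calc bump ((2:ℝ) ^ a) x y * bumpSum P L y ^ (n + 1)
          ≤ bump ((2:ℝ) ^ a) x y * ((n + 1) * ∑ l ∈ L, ∑ x' ∈ P l,
              bump ((2:ℝ) ^ l) x' y * bumpSum P (L.filter (l ≤ ·)) y ^ n) := by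
            gcongr
            exact bumpSum_pow_succ_le P L n y
        _ = (n + 1) * ∑ l ∈ L, ∑ x' ∈ P l, (bump ((2:ℝ) ^ a) x y * bump ((2:ℝ) ^ l) x' y) *
              bumpSum P (L.filter (l ≤ ·)) y ^ n := by
            simp only [Finset.mul_sum]
            refine Finset.sum_congr rfl fun l _ => Finset.sum_congr rfl fun x' _ => ?_
            ring
        _ ≤ _ := by
            refine mul_le_mul_of_nonneg_left (Finset.sum_le_sum fun l hl =>
              Finset.sum_le_sum fun x' hx' => ?_) (by positivity)
            have h1 := bump_mul_bump_le (u := (2:ℝ) ^ a) (v := (2:ℝ) ^ l) (by positivity)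
              (zpow_le_zpow_right₀ one_le_two (hL l hl)) x x' y
            have h2 := bumpSum_nonneg P (L.filter (l ≤ ·)) y
            have h3 : bumpSum P (L.filter (l ≤ ·)) y ^ n ≤ bumpSum P L y ^ n := by
              gcongr
              exact bumpSum_mono P (Finset.filter_subset _ _) y
            calc _ ≤ (4 * bump ((2:ℝ) ^ a) x x' * (bump ((2:ℝ) ^ l) x' y +
                    ((2:ℝ) ^ a / (2:ℝ) ^ l) ^ 2 * bump ((2:ℝ) ^ a) x y)) *
                    bumpSum P (L.filter (l ≤ ·)) y ^ n := by gcongr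
              _ = c l x' * (F l x' y + r l * (bump ((2:ℝ) ^ a) x y *
                    bumpSum P (L.filter (l ≤ ·)) y ^ n)) := by
                  simp only [hc, hF, hr]; ring
              _ ≤ _ := by
                  have := hc0 l x'
                  simp only [hf]
                  gcongr
    have hfb : ∫ y, f y ≤ C * (2:ℝ) ^ (-a) * A ^ n := ih m P L A a x hsep hL hA hcard
    have hFb : ∀ l ∈ L, ∀ x' ∈ P l, ∫ y, F l x' y ≤ C * (2:ℝ) ^ (-l) * A ^ n := by
      intro l hl x' _
      refine ih m P _ A l x' (hsep.subset (Finset.filter_subset _ _))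
        (fun j hj => (Finset.mem_filter.1 hj).2) hA (le_trans ?_ hcard)
      gcongr
      exact Finset.filter_subset _ _
    have hexp : ∀ l ∈ L, (2:ℝ) ^ (-l) + r l * (2:ℝ) ^ (-a) ≤
        2 * (2:ℝ) ^ (-a) * (2:ℝ) ^ (a - l) := by
      intro l hl
      have h1 : (2:ℝ) ^ (-l) = (2:ℝ) ^ (-a) * (2:ℝ) ^ (a - l) := by
        rw [← zpow_add₀ two_ne_zero]; congr 1; ring
      have h2 : r l ≤ (2:ℝ) ^ (a - l) := by
        have h3 : (2:ℝ) ^ a / (2:ℝ) ^ l = (2:ℝ) ^ (a - l) := by rw [zpow_sub₀ two_ne_zero]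
        have h4 : (2:ℝ) ^ (a - l) ≤ 1 :=
          zpow_le_one_of_nonpos₀ one_le_two (by linarith [hL l hl])
        have h5 : (0:ℝ) < (2:ℝ) ^ (a - l) := by positivity
        simp only [hr, h3]
        nlinarith
      have h6 : (0:ℝ) < (2:ℝ) ^ (-a) := by positivity
      rw [h1]
      nlinarith
    have hcount : ∀ l ∈ L, (2:ℝ) ^ (a - l) * ∑ x' ∈ P l, bump ((2:ℝ) ^ a) x x' ≤
        4 * bumpMass * (expDecay 1 (a - l) + (2:ℝ) ^ (-(m:ℤ))) := by
      intro l hl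
      have h1 := sum_bump_le (u := (2:ℝ) ^ a) (d := (2:ℝ) ^ ((m:ℤ) - l)) (by positivity)
        (by positivity) (P l) (hsep l hl) x
      have h2 : (2:ℝ) ^ (a - l) * (1 / ((2:ℝ) ^ a * (2:ℝ) ^ ((m:ℤ) - l))) = (2:ℝ) ^ (-(m:ℤ)) := by
        rw [one_div, ← zpow_add₀ two_ne_zero, ← zpow_neg, ← zpow_add₀ two_ne_zero]
        congr 1; ring
      have h3 : (2:ℝ) ^ (a - l) = expDecay 1 (a - l) := by
        have : ((a - l : ℤ) : ℝ) ≤ 0 := by exact_mod_cast sub_nonpos.2 (hL l hl)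
        rw [expDecay, abs_of_nonpos this, one_mul, neg_neg, Real.rpow_intCast]
      calc _ ≤ (2:ℝ) ^ (a - l) *
            (4 * bumpMass * (1 + 1 / ((2:ℝ) ^ a * (2:ℝ) ^ ((m:ℤ) - l)))) := by gcongr
        _ = 4 * bumpMass * ((2:ℝ) ^ (a - l) +
            (2:ℝ) ^ (a - l) * (1 / ((2:ℝ) ^ a * (2:ℝ) ^ ((m:ℤ) - l)))) := by ring
        _ = _ := by rw [h2, h3]
    have hint : ∀ l ∈ L, ∀ x' ∈ P l, Integrable fun y => c l x' * (F l x' y + r l * f y) :=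
      fun l _ x' _ => ((hFi l x').add (hfi.const_mul _)).const_mul _
    calc ∫ y, bump ((2:ℝ) ^ a) x y * bumpSum P L y ^ (n + 1)
        ≤ ∫ y, (n + 1) * ∑ l ∈ L, ∑ x' ∈ P l, c l x' * (F l x' y + r l * f y) := by
          refine integral_mono (integrable_mul_bumpSum_pow P L _
            (integrable_bump (by positivity) x)) ?_ hpt
          exact (integrable_finsetSum _ fun l hl =>
            integrable_finsetSum _ fun x' hx' => hint l hl x' hx').const_mul _
      _ = (n + 1) * ∑ l ∈ L, ∑ x' ∈ P l, c l x' * (∫ y, F l x' y + r l * f y) := by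
          rw [integral_const_mul, integral_finsetSum _ fun l hl =>
            integrable_finsetSum _ fun x' hx' => hint l hl x' hx']
          congr 1
          refine Finset.sum_congr rfl fun l hl => ?_
          rw [integral_finsetSum _ fun x' hx' => hint l hl x' hx']
          exact Finset.sum_congr rfl fun x' _ => integral_const_mul _ _
      _ ≤ (n + 1) * ∑ l ∈ L, ∑ x' ∈ P l,
            c l x' * (2 * C * (2:ℝ) ^ (-a) * A ^ n * (2:ℝ) ^ (a - l)) := by
          gcongr with l hl x' hx'
          · exact hc0 l x'
          · rw [integral_add (hFi l x') (hfi.const_mul _), integral_const_mul]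
            have hr0 : 0 ≤ r l := sq_nonneg _
            calc _ ≤ C * (2:ℝ) ^ (-l) * A ^ n + r l * (C * (2:ℝ) ^ (-a) * A ^ n) := by
                  gcongr
                  exact hFb l hl x' hx'
              _ = C * A ^ n * ((2:ℝ) ^ (-l) + r l * (2:ℝ) ^ (-a)) := by ring
              _ ≤ C * A ^ n * (2 * (2:ℝ) ^ (-a) * (2:ℝ) ^ (a - l)) := by
                  gcongr
                  exact hexp l hl
              _ = _ := by ring
      _ = (n + 1) * (8 * C * (2:ℝ) ^ (-a) * A ^ n *
            ∑ l ∈ L, (2:ℝ) ^ (a - l) * ∑ x' ∈ P l, bump ((2:ℝ) ^ a) x x') := by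
          simp only [Finset.mul_sum]
          refine Finset.sum_congr rfl fun l _ => Finset.sum_congr rfl fun x' _ => ?_
          simp only [hc]; ring
      _ ≤ (n + 1) * (8 * C * (2:ℝ) ^ (-a) * A ^ n *
            ∑ l ∈ L, 4 * bumpMass * (expDecay 1 (a - l) + (2:ℝ) ^ (-(m:ℤ)))) := by
          refine mul_le_mul_of_nonneg_left (mul_le_mul_of_nonneg_left
            (Finset.sum_le_sum hcount) (by positivity)) (by positivity)
      _ = (n + 1) * (8 * C * (2:ℝ) ^ (-a) * A ^ n * (4 * bumpMass *
            (∑ l ∈ L, expDecay 1 (a - l) + (2:ℝ) ^ (-(m:ℤ)) * L.card))) := by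
          rw [← Finset.mul_sum, Finset.sum_add_distrib, Finset.sum_const, nsmul_eq_mul,
            mul_comm (L.card : ℝ)]
      _ ≤ (n + 1) * (8 * C * (2:ℝ) ^ (-a) * A ^ n * (4 * bumpMass * (S * A + A))) := by
          gcongr
          exact (sum_expDecay_le one_pos L a).trans (le_mul_of_one_le_right hS.le hA)
      _ = _ := by ring

/-- Moment bounds for the sum of bumps. -/
lemma exists_integral_bumpSum_pow_le (n : ℕ) :
    ∃ C : ℝ, 0 ≤ C ∧ ∀ (m : ℕ) (P : ℤ → Finset ℝ) (L : Finset ℤ),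
      Separated m P L → (∀ l ∈ L, (m:ℤ) ≤ l) → (∀ l ∈ L, ↑(P l) ⊆ Set.Icc (0:ℝ) 1) →
      1 ≤ (2:ℝ) ^ (-(m:ℤ)) * L.card →
      Integrable (fun y => bumpSum P L y ^ (n + 1)) ∧
      ∫ y, bumpSum P L y ^ (n + 1) ≤ C * ((2:ℝ) ^ (-(m:ℤ)) * L.card) ^ (n + 1) := by
  obtain ⟨C, hC, h⟩ := exists_integral_bump_mul_bumpSum_pow_le n
  have hB := bumpMass_nonneg
  refine ⟨(n + 1) * (C * (32 * bumpMass)), by positivity, fun m P L hsep hL hP hA => ?_⟩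
  have hi : Integrable (fun y => bumpSum P L y ^ (n + 1)) := by
    simp_rw [pow_succ']
    exact integrable_mul_bumpSum_pow P L n (integrable_bumpSum P L)
  refine ⟨hi, ?_⟩
  set A := (2:ℝ) ^ (-(m:ℤ)) * L.card with hAdef
  have hA0 : 0 ≤ A := by linarith
  set F : ℤ → ℝ → ℝ → ℝ := fun l x' y =>
    bump ((2:ℝ) ^ l) x' y * bumpSum P (L.filter (l ≤ ·)) y ^ n with hF
  have hFi : ∀ l x', Integrable (F l x') := fun l x' =>
    integrable_mul_bumpSum_pow P _ n (integrable_bump (by positivity) x')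
  have hcardP : ∀ l ∈ L, (2:ℝ) ^ (-l) * (P l).card ≤ 32 * bumpMass * (2:ℝ) ^ (-(m:ℤ)) := by
    intro l hl
    have h1 := sum_bump_le (u := 1) (d := (2:ℝ) ^ ((m:ℤ) - l)) one_pos (by positivity) (P l)
      (hsep l hl) 0
    have h2 : ((P l).card : ℝ) ≤ 4 * ∑ x ∈ P l, bump 1 0 x := by
      rw [Finset.mul_sum, Finset.card_eq_sum_ones, Nat.cast_sum]
      refine Finset.sum_le_sum fun x hx => ?_
      have hx' := hP l hl hx
      simp only [bump, sub_zero, one_mul, abs_of_nonneg hx'.1, Nat.cast_one]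
      rw [← div_eq_mul_inv, le_div_iff₀ (by nlinarith [hx'.1])]
      nlinarith [hx'.1, hx'.2]
    have h3 : 1 / (1 * (2:ℝ) ^ ((m:ℤ) - l)) = (2:ℝ) ^ (l - m) := by
      rw [one_mul, one_div, ← zpow_neg]; congr 1; ring
    have h4 : (1:ℝ) ≤ (2:ℝ) ^ (l - m) := one_le_zpow₀ one_le_two (by linarith [hL l hl])
    rw [h3] at h1
    calc (2:ℝ) ^ (-l) * (P l).card
        ≤ (2:ℝ) ^ (-l) * (4 * (4 * bumpMass * (2 * (2:ℝ) ^ (l - m)))) := by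
          gcongr
          refine h2.trans ?_
          gcongr
          refine h1.trans ?_
          gcongr
          linarith
      _ = 32 * bumpMass * ((2:ℝ) ^ (-l) * (2:ℝ) ^ (l - m)) := by ring
      _ = _ := by
          rw [← zpow_add₀ two_ne_zero]; congr 2; ring
  calc ∫ y, bumpSum P L y ^ (n + 1) ≤ ∫ y, (n + 1) * ∑ l ∈ L, ∑ x ∈ P l, F l x y := by
        refine integral_mono hi ?_ (bumpSum_pow_succ_le P L n)
        exact (integrable_finsetSum _ fun l _ => integrable_finsetSum _ fun x _ =>
          hFi l x).const_mul _
    _ = (n + 1) * ∑ l ∈ L, ∑ x ∈ P l, ∫ y, F l x y := by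
        rw [integral_const_mul, integral_finsetSum _ fun l _ =>
          integrable_finsetSum _ fun x _ => hFi l x]
        congr 1
        exact Finset.sum_congr rfl fun l _ => integral_finsetSum _ fun x _ => hFi l x
    _ ≤ (n + 1) * ∑ l ∈ L, ∑ x ∈ P l, C * (2:ℝ) ^ (-l) * A ^ n := by
        gcongr with l hl x hx
        refine h m P _ A l x (hsep.subset (Finset.filter_subset _ _))
          (fun j hj => (Finset.mem_filter.1 hj).2) hA ?_
        rw [hAdef]
        gcongr
        exact Finset.filter_subset _ _
    _ = (n + 1) * (C * A ^ n * ∑ l ∈ L, (2:ℝ) ^ (-l) * (P l).card) := by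
        simp only [Finset.sum_const, nsmul_eq_mul, Finset.mul_sum]
        refine Finset.sum_congr rfl fun l _ => ?_
        ring
    _ ≤ (n + 1) * (C * A ^ n * ∑ l ∈ L, 32 * bumpMass * (2:ℝ) ^ (-(m:ℤ))) := by
        refine mul_le_mul_of_nonneg_left (mul_le_mul_of_nonneg_left
          (Finset.sum_le_sum hcardP) (by positivity)) (by positivity)
    _ = _ := by
        rw [Finset.sum_const, nsmul_eq_mul, hAdef]; ring

/-- Smooth functions supported in `[-1/2, 1/2]`. -/
structure IsTestFn (f : ℝ → ℂ) : Prop where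
  contDiff : ContDiff ℝ (⊤ : ℕ∞) f
  support_subset : Function.support f ⊆ Set.Icc (-(1/2) : ℝ) (1/2)

namespace IsTestFn

variable {f : ℝ → ℂ}

lemma continuous (hf : IsTestFn f) : Continuous f := hf.contDiff.continuous

lemma tsupport_subset (hf : IsTestFn f) : tsupport f ⊆ Set.Icc (-(1/2) : ℝ) (1/2) :=
  closure_minimal hf.support_subset isClosed_Icc

lemma hasCompactSupport (hf : IsTestFn f) : HasCompactSupport f :=
  HasCompactSupport.of_support_subset_isCompact isCompact_Icc hf.support_subset

lemma integrable_mul (hf : IsTestFn f) {g : ℝ → ℂ} (hg : Continuous g) :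
    Integrable fun v => f v * g v :=
  (hf.continuous.mul hg).integrable_of_hasCompactSupport hf.hasCompactSupport.mul_right

lemma hasDerivAt (hf : IsTestFn f) (v : ℝ) : HasDerivAt f (deriv f v) v :=
  (hf.contDiff.differentiable (by simp) v).hasDerivAt

lemma deriv (hf : IsTestFn f) : IsTestFn (deriv f) where
  contDiff := (contDiff_infty_iff_deriv.1 hf.contDiff).2
  support_subset := (support_deriv_subset).trans hf.tsupport_subset

/-- A test function with vanishing integral and moments is the derivative of a test function with
one vanishing moment less. -/
lemma exists_primitive (hf : IsTestFn f) {M : ℕ}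
    (hmom : ∀ n < M + 1, ∫ x : ℝ, f x * (x:ℂ) ^ n = 0) :
    ∃ H : ℝ → ℂ, IsTestFn H ∧ _root_.deriv H = f ∧
      ∀ n < M, ∫ x : ℝ, H x * (x:ℂ) ^ n = 0 := by
  set H : ℝ → ℂ := fun v => ∫ t in (-1:ℝ)..v, f t with hH
  have hd : ∀ v, HasDerivAt H (f v) v := fun v =>
    intervalIntegral.integral_hasDerivAt_right (hf.continuous.intervalIntegrable _ _)
      hf.continuous.stronglyMeasurable.stronglyMeasurableAtFilter hf.continuous.continuousAt
  have hderiv : _root_.deriv H = f := funext fun v => (hd v).deriv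
  have hHt : IsTestFn H := by
    refine ⟨contDiff_infty_iff_deriv.2 ⟨fun v => (hd v).differentiableAt, ?_⟩, ?_⟩
    · rw [hderiv]; exact hf.contDiff
    · rw [Function.support_subset_iff']
      intro v hv
      rw [Set.mem_Icc, not_and_or, not_le, not_le] at hv
      rcases hv with hv | hv
      · refine intervalIntegral.integral_zero_ae (Filter.Eventually.of_forall fun t ht => ?_)
        by_contra h
        have h1 := (hf.support_subset h).1
        rw [Set.mem_uIoc] at ht
        rcases ht with ht | ht <;> linarith [ht.1, ht.2]
      · have h0 := hmom 0 (by omega)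
        simp only [pow_zero, mul_one] at h0
        rw [hH, ← h0]
        refine intervalIntegral.integral_eq_integral_of_support_subset fun t ht => ?_
        have := hf.support_subset ht
        exact ⟨by linarith [this.1], by linarith [this.2]⟩
  refine ⟨H, hHt, hderiv, fun n hn => ?_⟩
  have hv : ∀ x : ℝ, HasDerivAt (fun x : ℝ => (x:ℂ) ^ (n + 1)) ((n + 1) * (x:ℂ) ^ n) x := by
    intro x
    have := (hasDerivAt_pow (n + 1) (x:ℂ)).comp_ofReal
    simpa using this
  have hibp := integral_mul_deriv_eq_deriv_mul_of_integrable (u := H)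
    (v := fun x : ℝ => (x:ℂ) ^ (n + 1)) (fun x _ => hd x) (fun x _ => hv x)
    (hHt.integrable_mul (by fun_prop)) (hf.integrable_mul (by fun_prop))
    (hHt.integrable_mul (by fun_prop))
  rw [hmom (n + 1) (by omega), neg_zero] at hibp
  have h2 : ∫ x : ℝ, H x * ((n + 1) * (x:ℂ) ^ n) = (n + 1) * ∫ x : ℝ, H x * (x:ℂ) ^ n := by
    rw [← integral_const_mul]
    congr 1 with x
    ring
  rw [h2] at hibp
  exact (mul_eq_zero.1 hibp).resolve_left (by exact_mod_cast Nat.succ_ne_zero n)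

end IsTestFn

lemma SchwartzMap.exists_norm_le_bump (Ψ : SchwartzMap ℝ ℂ) :
    ∃ C : ℝ, 0 ≤ C ∧ ∀ t, ‖Ψ t‖ ≤ C * bump 1 0 t := by
  have h := fun t => SchwartzMap.one_add_le_sup_seminorm_apply (𝕜 := ℝ) (m := (2, 0)) (k := 2)
    (n := 0) le_rfl le_rfl Ψ t
  simp only [norm_iteratedFDeriv_zero] at h
  refine ⟨_, (by positivity : (0:ℝ) ≤ (1 + ‖(0:ℝ)‖) ^ 2 * ‖Ψ 0‖).trans (h 0), fun t => ?_⟩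
  simp only [bump, sub_zero, one_mul]
  rw [← div_eq_mul_inv, le_div_iff₀ (by positivity), mul_comm]
  exact h t

/-- The pairing of a test function with a dilated and translated Schwartz function. -/
def pairing (f Ψ : ℝ → ℂ) (R z : ℝ) : ℂ := ∫ v : ℝ, f v * Ψ (R * (z - v))

lemma exists_norm_pairing_le {f : ℝ → ℂ} (hf : IsTestFn f) (Ψ : SchwartzMap ℝ ℂ) :
    ∃ C : ℝ, 0 ≤ C ∧ ∀ ρ R z : ℝ, 0 < ρ → ρ ≤ R → ρ ≤ 1 →
      ‖pairing f Ψ R z‖ ≤ C * bump ρ 0 z := by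
  obtain ⟨C, hC, hΨ⟩ := Ψ.exists_norm_le_bump
  have hi : 0 ≤ ∫ v, ‖f v‖ := integral_nonneg fun _ => norm_nonneg _
  refine ⟨(∫ v, ‖f v‖) * (4 * C), by positivity, fun ρ R z hρ hρR hρ1 => ?_⟩
  have hfi : Integrable f := hf.continuous.integrable_of_hasCompactSupport hf.hasCompactSupport
  rw [mul_assoc, ← integral_mul_const]
  refine norm_integral_le_of_norm_le (hfi.norm.mul_const _)
    (Filter.Eventually.of_forall fun v => ?_)
  rw [norm_mul]
  by_cases hv : f v = 0
  · simp [hv]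
  have hv' := hf.support_subset hv
  have hva : |v| ≤ 1 / 2 := abs_le.2 hv'
  gcongr
  refine (hΨ _).trans ?_
  rw [mul_assoc, mul_left_comm]
  refine mul_le_mul_of_nonneg_left ?_ hC
  have hR : 0 < R := hρ.trans_le hρR
  have htri : |z| ≤ |z - v| + |v| := by simpa using abs_add_le (z - v) v
  have h1 : (1 + ρ * |z|) / 2 ≤ 1 + R * |z - v| := by
    have : ρ * |z - v| ≤ R * |z - v| := by gcongr
    nlinarith [abs_nonneg (z - v), abs_nonneg v]
  simp only [bump, sub_zero, one_mul, abs_mul, abs_of_pos hR]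
  rw [show 4 * ((1 + ρ * |z|) ^ 2)⁻¹ = (((1 + ρ * |z|) / 2) ^ 2)⁻¹ by field_simp; norm_num]
  gcongr

lemma pairing_deriv {f : ℝ → ℂ} (hf : IsTestFn f) {Ψ Ψ' : ℝ → ℂ}
    (hΨ : ∀ t, HasDerivAt Ψ (Ψ' t) t) (hΨ' : Continuous Ψ') (R z : ℝ) :
    pairing (deriv f) Ψ R z = R * pairing f Ψ' R z := by
  have hc : Continuous Ψ := continuous_iff_continuousAt.2 fun t => (hΨ t).continuousAt
  have hv : ∀ v : ℝ, HasDerivAt (fun v => Ψ (R * (z - v))) (-R * Ψ' (R * (z - v))) v := by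
    intro v
    have h1 : HasDerivAt (fun v : ℝ => R * (z - v)) (-R) v := by
      simpa using ((hasDerivAt_id v).const_sub z).const_mul R
    simpa [Function.comp_def] using (hΨ (R * (z - v))).scomp v h1
  have hibp := integral_mul_deriv_eq_deriv_mul_of_integrable (u := f)
    (v := fun v => Ψ (R * (z - v))) (fun x _ => hf.hasDerivAt x) (fun x _ => hv x)
    (hf.integrable_mul (by fun_prop)) (hf.deriv.integrable_mul (by fun_prop))
    (hf.integrable_mul (by fun_prop))
  have h2 : ∫ v : ℝ, f v * (-R * Ψ' (R * (z - v))) = -(R * pairing f Ψ' R z) := by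
    rw [pairing, ← integral_const_mul, ← integral_neg]
    congr 1 with x
    ring
  rw [h2, neg_inj] at hibp
  exact hibp.symm

lemma SchwartzMap.hasDerivAt_derivCLM (Ψ : SchwartzMap ℝ ℂ) (t : ℝ) :
    HasDerivAt Ψ (SchwartzMap.derivCLM ℂ ℂ Ψ t) t := by
  simpa using Ψ.differentiableAt.hasDerivAt

/-- Low-frequency estimate from the vanishing moments of the test function. -/
lemma exists_norm_pairing_le_of_moments (M : ℕ) : ∀ {f : ℝ → ℂ}, IsTestFn f →
    (∀ n < M, ∫ x : ℝ, f x * (x:ℂ) ^ n = 0) → ∀ Ψ : SchwartzMap ℝ ℂ,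
    ∃ C : ℝ, 0 ≤ C ∧ ∀ R z : ℝ, 0 < R → R ≤ 1 →
      ‖pairing f Ψ R z‖ ≤ C * R ^ M * bump R 0 z := by
  induction M with
  | zero =>
    intro f hf _ Ψ
    obtain ⟨C, hC, h⟩ := exists_norm_pairing_le hf Ψ
    exact ⟨C, hC, fun R z hR hR1 => by simpa using h R R z hR le_rfl hR1⟩
  | succ M ih =>
    intro f hf hmom Ψ
    obtain ⟨H, hH, rfl, hHm⟩ := hf.exists_primitive hmom
    obtain ⟨C, hC, h⟩ := ih hH hHm (SchwartzMap.derivCLM ℂ ℂ Ψ)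
    refine ⟨C, hC, fun R z hR hR1 => ?_⟩
    rw [pairing_deriv hH Ψ.hasDerivAt_derivCLM (SchwartzMap.continuous _), norm_mul,
      Complex.norm_real, Real.norm_of_nonneg hR.le]
    calc R * _ ≤ R * (C * R ^ M * bump R 0 z) := by gcongr; exact h R z hR hR1
      _ = _ := by ring

/-- Smooth compactly supported functions vanishing on `[-1/2, 1/2]`. -/
structure IsAnnular (φ : ℝ → ℂ) : Prop where
  contDiff : ContDiff ℝ (⊤ : ℕ∞) φ
  hasCompactSupport : HasCompactSupport φ
  eq_zero : ∀ ξ, |ξ| ≤ 1 / 2 → φ ξ = 0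

lemma IsAnnular.div {φ : ℝ → ℂ} (hφ : IsAnnular φ) :
    IsAnnular fun ξ => φ ξ / (2 * π * Complex.I * ξ) where
  contDiff := by
    refine contDiff_iff_contDiffAt.2 fun ξ => ?_
    rcases lt_or_ge |ξ| (1 / 2) with h | h
    · refine (contDiffAt_const (c := (0:ℂ))).congr_of_eventuallyEq ?_
      filter_upwards [(isOpen_lt continuous_abs continuous_const).mem_nhds h] with ζ hζ
      rw [hφ.eq_zero ζ (le_of_lt hζ), zero_div]
    · have hξ : ξ ≠ 0 := by rintro rfl; norm_num at h
      simp_rw [div_eq_mul_inv]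
      refine hφ.contDiff.contDiffAt.mul (ContDiffAt.inv ?_ ?_)
      · exact contDiffAt_const.mul Complex.ofRealCLM.contDiff.contDiffAt
      · simp [hξ, Real.pi_ne_zero]
  hasCompactSupport := by
    simp_rw [div_eq_mul_inv]
    exact hφ.hasCompactSupport.mul_right
  eq_zero ξ h := by simp [hφ.eq_zero ξ h]

/-- The inverse Fourier transform of a smooth compactly supported function as a Schwartz map. -/
def invFourierSchwartz {φ : ℝ → ℂ} (h₁ : HasCompactSupport φ) (h₂ : ContDiff ℝ (⊤ : ℕ∞) φ) :
    SchwartzMap ℝ ℂ := 𝓕⁻ (h₁.toSchwartzMap h₂)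

lemma coe_invFourierSchwartz {φ : ℝ → ℂ} (h₁ : HasCompactSupport φ)
    (h₂ : ContDiff ℝ (⊤ : ℕ∞) φ) : ⇑(invFourierSchwartz h₁ h₂) = 𝓕⁻ φ := by
  rw [invFourierSchwartz, SchwartzMap.fourierInv_coe]
  rfl

lemma IsAnnular.hasDerivAt_fourierInv_div {φ : ℝ → ℂ} (hφ : IsAnnular φ) (x : ℝ) :
    HasDerivAt (𝓕⁻ fun ξ : ℝ => φ ξ / (2 * π * Complex.I * ξ)) (𝓕⁻ φ x) x := by
  set φ₁ : ℝ → ℂ := fun ξ => φ ξ / (2 * π * Complex.I * ξ) with hφ₁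
  have h1 : Integrable φ₁ :=
    hφ.div.contDiff.continuous.integrable_of_hasCompactSupport hφ.div.hasCompactSupport
  have h2 : Integrable fun ξ : ℝ => ξ • φ₁ ξ :=
    (continuous_id.smul hφ.div.contDiff.continuous).integrable_of_hasCompactSupport
      hφ.div.hasCompactSupport.smul_left
  have h3 := (Real.hasDerivAt_fourier h1 h2 (-x)).scomp x (hasDerivAt_neg x)
  have h4 : (𝓕⁻ φ₁ : ℝ → ℂ) = 𝓕 φ₁ ∘ Neg.neg := by
    ext t; exact Real.fourierInv_eq_fourier_neg φ₁ t
  have h5 : (fun ξ : ℝ => (-2 * π * Complex.I * ξ) • φ₁ ξ) = fun ξ => (-1 : ℂ) • φ ξ := by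
    ext ξ
    by_cases hξ : ξ = 0
    · simp [hξ, hφ.eq_zero 0 (by norm_num)]
    · have : (ξ : ℂ) ≠ 0 := by exact_mod_cast hξ
      have hpi : (π : ℂ) ≠ 0 := by exact_mod_cast Real.pi_ne_zero
      simp only [hφ₁, smul_eq_mul]
      field_simp [Complex.I_ne_zero]
  rw [h5] at h3
  have h6 : 𝓕 φ (-x) = (-1 : ℝ) • 𝓕 (fun ξ => (-1 : ℂ) • φ ξ) (-x) := by
    simp [Real.fourier_real_eq, integral_neg]
  rw [h4, Real.fourierInv_eq_fourier_neg, h6]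
  exact h3

/-- High-frequency estimate from the smoothness of the test function. -/
lemma exists_norm_pairing_le_of_annular (N : ℕ) : ∀ {f φ : ℝ → ℂ}, IsTestFn f → IsAnnular φ →
    ∃ C : ℝ, 0 ≤ C ∧ ∀ R z : ℝ, 1 ≤ R →
      ‖pairing f (𝓕⁻ φ) R z‖ ≤ C * (R ^ N)⁻¹ * bump 1 0 z := by
  induction N with
  | zero =>
    intro f φ hf hφ
    obtain ⟨C, hC, h⟩ := exists_norm_pairing_le hf
      (invFourierSchwartz hφ.hasCompactSupport hφ.contDiff)
    rw [coe_invFourierSchwartz] at h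
    exact ⟨C, hC, fun R z hR => by simpa using h 1 R z one_pos hR le_rfl⟩
  | succ N ih =>
    intro f φ hf hφ
    obtain ⟨C, hC, h⟩ := ih hf.deriv hφ.div
    refine ⟨C, hC, fun R z hR => ?_⟩
    have hcont : Continuous (𝓕⁻ φ : ℝ → ℂ) := by
      rw [← coe_invFourierSchwartz hφ.hasCompactSupport hφ.contDiff]
      exact SchwartzMap.continuous _
    have hR0 : 0 < R := by linarith
    have h1 := h R z hR
    rw [pairing_deriv hf hφ.hasDerivAt_fourierInv_div hcont, norm_mul,
      Complex.norm_real, Real.norm_of_nonneg hR0.le] at h1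
    calc ‖pairing f (𝓕⁻ φ) R z‖ = R⁻¹ * (R * ‖pairing f (𝓕⁻ φ) R z‖) := by field_simp
      _ ≤ R⁻¹ * (C * (R ^ N)⁻¹ * bump 1 0 z) := by gcongr
      _ = _ := by rw [pow_succ, mul_inv]; ring

lemma bump_le_inv_sq_mul {R : ℝ} (hR : 0 < R) (hR1 : R ≤ 1) (z : ℝ) :
    bump R 0 z ≤ (R ^ 2)⁻¹ * bump 1 0 z := by
  simp only [bump, sub_zero, one_mul]
  rw [← mul_inv, ← mul_pow]
  have : R * (1 + |z|) ≤ 1 + R * |z| := by linarith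
  gcongr

/-- The Fourier multiplier of the `k`-th Littlewood–Paley operator, rescaled to unit frequency. -/
def lpProfile (φ₀ : ℝ → ℂ) (k : ℕ) : ℝ → ℂ :=
  if k = 0 then φ₀ else fun ξ => φ₀ ξ - φ₀ (2 * ξ)

lemma LPop_eq (φ₀ : ℝ → ℂ) (k : ℕ) (g : ℝ → ℂ) (y : ℝ) :
    LPop φ₀ k g y = ∫ t, g t * ((2:ℂ) ^ k * 𝓕⁻ (lpProfile φ₀ k) ((2:ℝ) ^ k * (y - t))) := by
  unfold LPop lpProfile
  split_ifs with hk
  · simp [hk, conv]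
  · rfl

lemma isAnnular_sub_dilate {φ₀ : ℝ → ℂ} (hφsmooth : ContDiff ℝ (⊤ : ℕ∞) φ₀)
    (hφcpt : HasCompactSupport φ₀) (hφone : ∀ ξ : ℝ, |ξ| ≤ 4/3 → φ₀ ξ = 1) :
    IsAnnular fun ξ => φ₀ ξ - φ₀ (2 * ξ) where
  contDiff := hφsmooth.sub (hφsmooth.comp (contDiff_const.mul contDiff_id))
  hasCompactSupport := by
    refine hφcpt.sub ?_
    exact hφcpt.comp_homeomorph (Homeomorph.mulLeft₀ (2:ℝ) two_ne_zero)
  eq_zero ξ h := by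
    rw [hφone ξ (by linarith), hφone (2 * ξ) (by rw [abs_mul, abs_two]; linarith), sub_self]

/-- The two-sided almost-orthogonality estimate at unit scale. -/
lemma exists_scaled_pairing_le {s : ℝ} {M₀ : ℕ} (hs : -(M₀:ℝ) < s) {η φ₀ : ℝ → ℂ}
    (hη : IsTestFn η) (hηmom : ∀ n : ℕ, n ≤ M₀ → ∫ x : ℝ, η x * (x:ℂ) ^ n = 0)
    (hφsmooth : ContDiff ℝ (⊤ : ℕ∞) φ₀) (hφcpt : HasCompactSupport φ₀)
    (hφone : ∀ ξ : ℝ, |ξ| ≤ 4/3 → φ₀ ξ = 1) :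
    ∃ δ C : ℝ, 0 < δ ∧ 0 ≤ C ∧ ∀ (k : ℕ) (l : ℤ) (z : ℝ), 0 ≤ l →
      (2:ℝ) ^ (((k:ℝ) - l) * s) * ((2:ℝ) ^ ((k:ℤ) - l) *
        ‖pairing η (𝓕⁻ (lpProfile φ₀ k)) ((2:ℝ) ^ ((k:ℤ) - l)) z‖) ≤
        C * expDecay δ (k - l) * bump 1 0 z := by
  have hann := isAnnular_sub_dilate hφsmooth hφcpt hφone
  have hmom : ∀ n < M₀ + 1, ∫ x : ℝ, η x * (x:ℂ) ^ n = 0 := fun n hn => hηmom n (by omega)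
  obtain ⟨C₁, hC₁, h₁⟩ := exists_norm_pairing_le_of_moments (M₀ + 1) hη hmom
    (invFourierSchwartz hφcpt hφsmooth)
  obtain ⟨C₂, hC₂, h₂⟩ := exists_norm_pairing_le_of_moments (M₀ + 1) hη hmom
    (invFourierSchwartz hann.hasCompactSupport hann.contDiff)
  obtain ⟨N, hN⟩ := exists_nat_ge (s + 2)
  obtain ⟨C₃, hC₃, h₃⟩ := exists_norm_pairing_le_of_annular N hη hann
  rw [coe_invFourierSchwartz] at h₁ h₂
  set δ := min (s + M₀) 1 with hδ
  have hδ0 : 0 < δ := lt_min (by linarith) one_pos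
  refine ⟨δ, C₁ + C₂ + C₃, hδ0, by positivity, fun k l z hl => ?_⟩
  set j : ℤ := (k:ℤ) - l with hj
  set R : ℝ := (2:ℝ) ^ j with hRdef
  have hR : 0 < R := by positivity
  have hjr : (k:ℝ) - l = (j:ℝ) := by rw [hj]; push_cast; ring
  have hRr : R = (2:ℝ) ^ (j:ℝ) := by rw [Real.rpow_intCast]
  have hRs : (2:ℝ) ^ (((k:ℝ) - l) * s) = R ^ s := by
    rw [hjr, hRr, ← Real.rpow_mul (by norm_num)]
  have hb := (bump_pos one_pos 0 z).le
  have he := (expDecay_pos δ j).le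
  rw [hRs]
  rcases le_or_gt j 0 with hj0 | hj0
  · have hR1 : R ≤ 1 := zpow_le_one_of_nonpos₀ one_le_two hj0
    have hp : ‖pairing η (𝓕⁻ (lpProfile φ₀ k)) R z‖ ≤
        (C₁ + C₂ + C₃) * R ^ (M₀ + 1) * bump R 0 z := by
      have hbR := (bump_pos hR 0 z).le
      unfold lpProfile
      split_ifs
      · refine (h₁ R z hR hR1).trans ?_
        gcongr; linarith
      · refine (h₂ R z hR hR1).trans ?_
        gcongr; linarith
    have hpow : R ^ s * (R * (R ^ (M₀ + 1) * (R ^ 2)⁻¹)) ≤ expDecay δ j := by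
      have h1 : R * (R ^ (M₀ + 1) * (R ^ 2)⁻¹) = R ^ (M₀:ℝ) := by
        rw [Real.rpow_natCast]; field_simp; ring
      have hj' : (j:ℝ) ≤ 0 := by exact_mod_cast hj0
      rw [h1, ← Real.rpow_add hR, hRr, ← Real.rpow_mul (by norm_num), expDecay,
        abs_of_nonpos hj']
      refine Real.rpow_le_rpow_of_exponent_le one_le_two ?_
      nlinarith [min_le_left (s + M₀) 1]
    calc R ^ s * (R * ‖pairing η (𝓕⁻ (lpProfile φ₀ k)) R z‖)
        ≤ R ^ s * (R * ((C₁ + C₂ + C₃) * R ^ (M₀ + 1) * ((R ^ 2)⁻¹ * bump 1 0 z))) := by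
          gcongr
          refine hp.trans ?_
          gcongr
          exact bump_le_inv_sq_mul hR hR1 z
      _ = (C₁ + C₂ + C₃) * (R ^ s * (R * (R ^ (M₀ + 1) * (R ^ 2)⁻¹))) * bump 1 0 z := by ring
      _ ≤ _ := by gcongr
  · have hR1 : 1 ≤ R := one_le_zpow₀ one_le_two hj0.le
    have hk : k ≠ 0 := by omega
    have hp : ‖pairing η (𝓕⁻ (lpProfile φ₀ k)) R z‖ ≤
        (C₁ + C₂ + C₃) * (R ^ N)⁻¹ * bump 1 0 z := by
      rw [lpProfile, if_neg hk]
      refine (h₃ R z hR1).trans ?_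
      gcongr; linarith
    have hpow : R ^ s * (R * (R ^ N)⁻¹) ≤ expDecay δ j := by
      have h1 : R * (R ^ N)⁻¹ = R ^ (1 - N : ℝ) := by
        rw [Real.rpow_sub hR, Real.rpow_one, Real.rpow_natCast, div_eq_mul_inv]
      have hj' : (0:ℝ) ≤ j := by exact_mod_cast hj0.le
      rw [h1, ← Real.rpow_add hR, hRr, ← Real.rpow_mul (by norm_num), expDecay,
        abs_of_nonneg hj']
      refine Real.rpow_le_rpow_of_exponent_le one_le_two ?_
      nlinarith [min_le_right (s + M₀) 1]
    calc R ^ s * (R * ‖pairing η (𝓕⁻ (lpProfile φ₀ k)) R z‖)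
        ≤ R ^ s * (R * ((C₁ + C₂ + C₃) * (R ^ N)⁻¹ * bump 1 0 z)) := by gcongr
      _ = (C₁ + C₂ + C₃) * (R ^ s * (R * (R ^ N)⁻¹)) * bump 1 0 z := by ring
      _ ≤ _ := by gcongr

lemma integral_atom_mul_kernel (η Ψ : ℝ → ℂ) (k : ℕ) (l : ℤ) (x y : ℝ) :
    ∫ t : ℝ, η ((2:ℝ) ^ l * (t - x)) * ((2:ℂ) ^ k * Ψ ((2:ℝ) ^ k * (y - t))) =
      (((2:ℝ) ^ ((k:ℤ) - l) : ℝ) : ℂ) *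
        pairing η Ψ ((2:ℝ) ^ ((k:ℤ) - l)) ((2:ℝ) ^ l * (y - x)) := by
  have hu : (0:ℝ) < (2:ℝ) ^ l := by positivity
  set R : ℝ := (2:ℝ) ^ ((k:ℤ) - l) with hR
  have hRu : R * (2:ℝ) ^ l = (2:ℝ) ^ k := by
    rw [hR, ← zpow_add₀ two_ne_zero, sub_add_cancel, zpow_natCast]
  set G : ℝ → ℂ := fun v => η v * ((2:ℂ) ^ k * Ψ (R * ((2:ℝ) ^ l * (y - x) - v))) with hG
  have h1 : ∀ t : ℝ, η ((2:ℝ) ^ l * (t - x)) * ((2:ℂ) ^ k * Ψ ((2:ℝ) ^ k * (y - t))) =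
      G ((2:ℝ) ^ l * (t - x)) := by
    intro t
    simp only [hG, ← hRu]
    congr 3
    ring
  simp_rw [h1]
  rw [integral_sub_right_eq_self (fun t => G ((2:ℝ) ^ l * t)) x,
    Measure.integral_comp_mul_left G, abs_of_pos (by positivity)]
  have h2 : ∫ v, G v = (2:ℂ) ^ k * pairing η Ψ R ((2:ℝ) ^ l * (y - x)) := by
    rw [pairing, ← integral_const_mul]
    congr 1 with v
    simp only [hG]; ring
  rw [h2, Complex.real_smul, ← mul_assoc]
  congr 1
  have h3 : ((2:ℝ) ^ l)⁻¹ * (2:ℝ) ^ k = R := by rw [← hRu]; field_simp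
  rw [← h3]; push_cast; rfl

/-- Pointwise bound for the Littlewood–Paley pieces of a sum of rescaled atoms. -/
lemma exists_LPop_le {s : ℝ} {M₀ : ℕ} (hs : -(M₀:ℝ) < s) {η φ₀ : ℝ → ℂ}
    (hη : IsTestFn η) (hηmom : ∀ n : ℕ, n ≤ M₀ → ∫ x : ℝ, η x * (x:ℂ) ^ n = 0)
    (hφsmooth : ContDiff ℝ (⊤ : ℕ∞) φ₀) (hφcpt : HasCompactSupport φ₀)
    (hφone : ∀ ξ : ℝ, |ξ| ≤ 4/3 → φ₀ ξ = 1) :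
    ∃ δ C : ℝ, 0 < δ ∧ 0 ≤ C ∧ ∀ (L : Finset ℤ) (P : ℤ → Finset ℝ) (a : ℤ → ℝ → ℂ),
      (∀ l ∈ L, 0 ≤ l) → (∀ l ∈ L, ∀ x ∈ P l, ‖a l x‖ ≤ 1) → ∀ (k : ℕ) (y : ℝ),
      (2:ℝ) ^ ((k:ℝ) * s) * ‖LPop φ₀ k (fun y => ∑ l ∈ L, ((2:ℝ)^(-(l:ℝ)*s) : ℝ) *
            ∑ x ∈ P l, a l x * η ((2:ℝ)^l * (y - x))) y‖ ≤
        C * ∑ l ∈ L, expDecay δ (k - l) * ∑ x ∈ P l, bump ((2:ℝ) ^ l) x y := by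
  obtain ⟨δ, C, hδ, hC, h⟩ :=
    exists_scaled_pairing_le hs hη hηmom hφsmooth hφcpt hφone
  refine ⟨δ, C, hδ, hC, fun L P a hL ha k y => ?_⟩
  set Ψ : ℝ → ℂ := 𝓕⁻ (lpProfile φ₀ k) with hΨ
  have hΨc : Continuous Ψ := by
    have hann := isAnnular_sub_dilate hφsmooth hφcpt hφone
    rw [hΨ]; unfold lpProfile
    split_ifs
    · rw [← coe_invFourierSchwartz hφcpt hφsmooth]; exact SchwartzMap.continuous _
    · rw [← coe_invFourierSchwartz hann.hasCompactSupport hann.contDiff]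
      exact SchwartzMap.continuous _
  set I : ℤ → ℝ → ℂ := fun l x =>
    ∫ t : ℝ, η ((2:ℝ) ^ l * (t - x)) * ((2:ℂ) ^ k * Ψ ((2:ℝ) ^ k * (y - t))) with hI
  have hint : ∀ (l : ℤ) (x : ℝ), Integrable fun t : ℝ =>
      η ((2:ℝ) ^ l * (t - x)) * ((2:ℂ) ^ k * Ψ ((2:ℝ) ^ k * (y - t))) := by
    intro l x
    have hu : (0:ℝ) < (2:ℝ) ^ l := by positivity
    have hcs : HasCompactSupport fun t : ℝ => η ((2:ℝ) ^ l * (t - x)) :=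
      hη.hasCompactSupport.comp_homeomorph
        ((Homeomorph.subRight x).trans (Homeomorph.mulLeft₀ ((2:ℝ) ^ l) hu.ne'))
    have hcont := hη.continuous
    exact Continuous.integrable_of_hasCompactSupport (by fun_prop) hcs.mul_right
  have hLP : LPop φ₀ k (fun y => ∑ l ∈ L, ((2:ℝ)^(-(l:ℝ)*s) : ℝ) *
            ∑ x ∈ P l, a l x * η ((2:ℝ)^l * (y - x))) y =
      ∑ l ∈ L, ∑ x ∈ P l, (((2:ℝ)^(-(l:ℝ)*s) : ℝ) * a l x) * I l x := by
    rw [LPop_eq, ← hΨ]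
    have hexpand : ∀ t : ℝ, (∑ l ∈ L, (((2:ℝ)^(-(l:ℝ)*s) : ℝ) : ℂ) *
            ∑ x ∈ P l, a l x * η ((2:ℝ)^l * (t - x))) *
            ((2:ℂ) ^ k * Ψ ((2:ℝ) ^ k * (y - t))) =
        ∑ l ∈ L, ∑ x ∈ P l, ((((2:ℝ)^(-(l:ℝ)*s) : ℝ) : ℂ) * a l x) *
          (η ((2:ℝ) ^ l * (t - x)) * ((2:ℂ) ^ k * Ψ ((2:ℝ) ^ k * (y - t)))) := by
      intro t
      simp only [Finset.sum_mul, Finset.mul_sum]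
      refine Finset.sum_congr rfl fun l _ => Finset.sum_congr rfl fun x _ => ?_
      ring
    simp_rw [hexpand]
    rw [integral_finsetSum _ fun l _ => integrable_finsetSum _ fun x _ =>
      (hint l x).const_mul _]
    refine Finset.sum_congr rfl fun l _ => ?_
    rw [integral_finsetSum _ fun x _ => (hint l x).const_mul _]
    exact Finset.sum_congr rfl fun x _ => integral_const_mul _ _
  have hatom : ∀ l ∈ L, ∀ x ∈ P l,
      (2:ℝ) ^ ((k:ℝ) * s) * ‖(((2:ℝ)^(-(l:ℝ)*s) : ℝ) * a l x) * I l x‖ ≤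
        C * expDecay δ (k - l) * bump ((2:ℝ) ^ l) x y := by
    intro l hl x hx
    have h1 := h k l ((2:ℝ) ^ l * (y - x)) (hL l hl)
    rw [← bump_eq_unit (by positivity)] at h1
    refine le_trans ?_ h1
    rw [norm_mul, norm_mul, Complex.norm_real, Real.norm_of_nonneg (by positivity),
      show I l x = _ from integral_atom_mul_kernel η Ψ k l x y, norm_mul, Complex.norm_real, Real.norm_of_nonneg (by positivity)]
    have h2 : (2:ℝ) ^ (((k:ℝ) - l) * s) = (2:ℝ) ^ ((k:ℝ) * s) * (2:ℝ) ^ (-(l:ℝ) * s) := by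
      rw [← Real.rpow_add two_pos]; congr 1; ring
    rw [h2]
    set T := (2:ℝ) ^ ((k:ℤ) - l) * ‖pairing η Ψ ((2:ℝ) ^ ((k:ℤ) - l)) ((2:ℝ) ^ l * (y - x))‖
    have hT : 0 ≤ T := by positivity
    calc (2:ℝ) ^ ((k:ℝ) * s) * ((2:ℝ) ^ (-(l:ℝ) * s) * ‖a l x‖ * T)
        ≤ (2:ℝ) ^ ((k:ℝ) * s) * ((2:ℝ) ^ (-(l:ℝ) * s) * 1 * T) := by
          gcongr
          exact ha l hl x hx
      _ = _ := by ring
  rw [hLP]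
  calc _ ≤ (2:ℝ) ^ ((k:ℝ) * s) * ∑ l ∈ L, ∑ x ∈ P l,
        ‖(((2:ℝ)^(-(l:ℝ)*s) : ℝ) * a l x) * I l x‖ := by
        gcongr
        exact (norm_sum_le _ _).trans (Finset.sum_le_sum fun l _ => norm_sum_le _ _)
    _ ≤ ∑ l ∈ L, ∑ x ∈ P l, C * expDecay δ (k - l) * bump ((2:ℝ) ^ l) x y := by
        simp only [Finset.mul_sum]
        exact Finset.sum_le_sum fun l hl => Finset.sum_le_sum fun x hx => hatom l hl x hx
    _ = _ := by
        simp only [Finset.mul_sum, mul_assoc]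

lemma tsum_ofReal_expDecay_le {δ : ℝ} (hδ : 0 < δ) (l : ℤ) :
    ∑' k : ℕ, ENNReal.ofReal (expDecay δ (k - l)) ≤ ENNReal.ofReal (∑' j, expDecay δ j) := by
  rw [ENNReal.ofReal_tsum_of_nonneg (fun j => (expDecay_pos δ j).le) (summable_expDecay hδ)]
  have hinj : Function.Injective fun k : ℕ => (k:ℤ) - l := fun a b h => by simpa using h
  exact ENNReal.tsum_comp_le_tsum_of_injective hinj fun j => ENNReal.ofReal (expDecay δ j)

/-- Summation of a sequence dominated by a discrete convolution with geometric decay. -/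
lemma tsum_rpow_le {δ q C W : ℝ} (hδ : 0 < δ) (hq : 1 ≤ q) (hC : 0 ≤ C) (L : Finset ℤ)
    (w : ℤ → ℝ) (hw0 : ∀ l, 0 ≤ w l) (hw : ∀ l ∈ L, w l ≤ W) (G : ℕ → ℝ) (hG0 : ∀ k, 0 ≤ G k)
    (hG : ∀ k : ℕ, G k ≤ C * ∑ l ∈ L, expDecay δ (k - l) * w l) :
    ∑' k, ENNReal.ofReal (G k ^ q) ≤
      ENNReal.ofReal ((C * (∑' j, expDecay δ j) * W) ^ (q - 1) * C * (∑' j, expDecay δ j) *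
        ∑ l ∈ L, w l) := by
  rcases L.eq_empty_or_nonempty with rfl | ⟨l₀, hl₀⟩
  · have : ∀ k, G k = 0 := fun k => le_antisymm (by simpa using hG k) (hG0 k)
    simp [this, Real.zero_rpow (by linarith : q ≠ 0)]
  have hW : 0 ≤ W := (hw0 l₀).trans (hw l₀ hl₀)
  set S := ∑' j, expDecay δ j
  have hS : 0 < S := tsum_expDecay_pos hδ
  set B := C * S * W
  have hB : 0 ≤ B := by positivity
  have hGB : ∀ k, G k ≤ B := fun k => by
    calc G k ≤ C * ∑ l ∈ L, expDecay δ (k - l) * w l := hG k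
      _ ≤ C * ∑ l ∈ L, expDecay δ (k - l) * W := by
          gcongr with l hl
          · exact (expDecay_pos _ _).le
          · exact hw l hl
      _ = C * (∑ l ∈ L, expDecay δ (k - l)) * W := by rw [← Finset.sum_mul, mul_assoc]
      _ ≤ C * S * W := by
          gcongr
          exact sum_expDecay_le hδ L k
  have hterm : ∀ k : ℕ, ENNReal.ofReal (G k ^ q) ≤
      ∑ l ∈ L, ENNReal.ofReal (B ^ (q - 1) * C * w l) * ENNReal.ofReal (expDecay δ (k - l)) := by
    intro k
    have h0 : ∀ l, 0 ≤ B ^ (q - 1) * C * w l := fun l => by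
      have := hw0 l
      positivity
    simp_rw [← ENNReal.ofReal_mul (h0 _)]
    rw [← ENNReal.ofReal_sum_of_nonneg fun l _ => mul_nonneg (h0 l) (expDecay_pos _ _).le]
    refine ENNReal.ofReal_le_ofReal ?_
    calc G k ^ q = G k ^ (q - 1) * G k := by
          rcases (hG0 k).eq_or_lt with h | h
          · rw [← h, Real.zero_rpow (by linarith), mul_zero]
          · rw [← Real.rpow_add_one h.ne', sub_add_cancel]
      _ ≤ B ^ (q - 1) * (C * ∑ l ∈ L, expDecay δ (k - l) * w l) := by
          exact mul_le_mul (Real.rpow_le_rpow (hG0 k) (hGB k) (by linarith)) (hG k) (hG0 k)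
            (by positivity)
      _ = _ := by
          simp only [Finset.mul_sum]
          refine Finset.sum_congr rfl fun l _ => ?_
          ring
  calc ∑' k, ENNReal.ofReal (G k ^ q)
      ≤ ∑' k : ℕ, ∑ l ∈ L,
          ENNReal.ofReal (B ^ (q - 1) * C * w l) * ENNReal.ofReal (expDecay δ (k - l)) :=
        ENNReal.tsum_le_tsum hterm
    _ = ∑ l ∈ L, ENNReal.ofReal (B ^ (q - 1) * C * w l) *
          ∑' k : ℕ, ENNReal.ofReal (expDecay δ (k - l)) := by
        rw [Summable.tsum_finsetSum fun _ _ => ENNReal.summable]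
        simp_rw [ENNReal.tsum_mul_left]
    _ ≤ ∑ l ∈ L, ENNReal.ofReal (B ^ (q - 1) * C * w l) * ENNReal.ofReal S := by
        gcongr with l
        exact tsum_ofReal_expDecay_le hδ l
    _ = _ := by
        have h0 : ∀ l, 0 ≤ B ^ (q - 1) * C * w l := fun l => by
          have := hw0 l
          positivity
        simp_rw [← ENNReal.ofReal_mul (h0 _)]
        rw [← ENNReal.ofReal_sum_of_nonneg fun l _ => mul_nonneg (h0 l) hS.le, Finset.mul_sum]
        congr 1
        refine Finset.sum_congr rfl fun l _ => ?_
        ring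

lemma rpow_le_add_pow {t r : ℝ} (ht : 0 ≤ t) (hr : 1 ≤ r) {n : ℕ} (hn : r ≤ n) :
    t ^ r ≤ t + t ^ n := by
  rcases le_total t 1 with h | h
  · have h1 : t ^ r ≤ t ^ (1:ℝ) := Real.rpow_le_rpow_of_exponent_ge' ht h zero_le_one hr
    rw [Real.rpow_one] at h1
    have : 0 ≤ t ^ n := by positivity
    linarith
  · have h1 : t ^ r ≤ t ^ (n:ℝ) := Real.rpow_le_rpow_of_exponent_le h hn
    rw [Real.rpow_natCast] at h1
    linarith

/-- Fractional moment bounds for the sum of bumps. -/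
lemma exists_lintegral_bumpSum_rpow_le {r : ℝ} (hr : 1 ≤ r) :
    ∃ C : ℝ, 0 ≤ C ∧ ∀ (m : ℕ) (P : ℤ → Finset ℝ) (L : Finset ℤ) (D : ℝ), 0 ≤ D →
      Separated m P L → (∀ l ∈ L, (m:ℤ) ≤ l) → (∀ l ∈ L, ↑(P l) ⊆ Set.Icc (0:ℝ) 1) →
      1 ≤ (2:ℝ) ^ (-(m:ℤ)) * L.card →
      ∫⁻ y, ENNReal.ofReal (D * bumpSum P L y) ^ r ≤
        ENNReal.ofReal ((D * ((2:ℝ) ^ (-(m:ℤ)) * L.card)) ^ r * C) := by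
  set N := ⌈r⌉₊
  have hN : r ≤ ((N + 1 : ℕ) : ℝ) := (Nat.le_ceil r).trans (by exact_mod_cast N.le_succ)
  obtain ⟨C₁, hC₁, h₁⟩ := exists_integral_bumpSum_pow_le 0
  obtain ⟨C₂, hC₂, h₂⟩ := exists_integral_bumpSum_pow_le N
  refine ⟨C₁ + C₂, by positivity, fun m P L D hD hsep hL hP hA => ?_⟩
  obtain ⟨hi₁, hb₁⟩ := h₁ m P L hsep hL hP hA
  obtain ⟨hi₂, hb₂⟩ := h₂ m P L hsep hL hP hA
  set A := (2:ℝ) ^ (-(m:ℤ)) * L.card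
  have hA0 : 0 < A := by linarith
  simp only [zero_add, pow_one] at hi₁ hb₁
  have hpt : ∀ y, ENNReal.ofReal (D * bumpSum P L y) ^ r ≤ ENNReal.ofReal ((D * A) ^ r *
      (bumpSum P L y / A + bumpSum P L y ^ (N + 1) / A ^ (N + 1))) := by
    intro y
    have hF := bumpSum_nonneg P L y
    rw [ENNReal.ofReal_rpow_of_nonneg (by positivity) (by linarith)]
    refine ENNReal.ofReal_le_ofReal ?_
    calc (D * bumpSum P L y) ^ r = (D * A) ^ r * (bumpSum P L y / A) ^ r := by
          rw [← Real.mul_rpow (by positivity) (by positivity)]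
          congr 1; field_simp
      _ ≤ (D * A) ^ r * (bumpSum P L y / A + (bumpSum P L y / A) ^ (N + 1)) := by
          gcongr
          exact rpow_le_add_pow (by positivity) hr hN
      _ = _ := by rw [div_pow]
  refine (lintegral_mono hpt).trans ?_
  have hi : Integrable fun y => (D * A) ^ r *
      (bumpSum P L y / A + bumpSum P L y ^ (N + 1) / A ^ (N + 1)) :=
    ((hi₁.div_const _).add (hi₂.div_const _)).const_mul _
  rw [← ofReal_integral_eq_lintegral_ofReal hi]
  · refine ENNReal.ofReal_le_ofReal ?_
    rw [integral_const_mul, integral_add (hi₁.div_const _) (hi₂.div_const _), integral_div,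
      integral_div]
    gcongr
    · rwa [div_le_iff₀ hA0]
    · rwa [div_le_iff₀ (by positivity)]
  · refine Filter.Eventually.of_forall fun y => ?_
    have hF := bumpSum_nonneg P L y
    show (0:ℝ) ≤ _
    positivity

/-- Test-function bound: $g=\sum_{l\in L}2^{-ls}\sum_{x\in P_l}a_{l,x}\eta(2^l(\cdot-x))$
satisfies $\|g\|_{F^s_{p,q}}\le C(2^{-m}\#L)^{1/q}$. -/
theorem test_function_Fnorm_bound
    (p q s : ℝ) (hq : 1 ≤ q) (hqp : q ≤ p) (M₀ : ℕ) (hs : -(M₀:ℝ) < s)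
    (η : ℝ → ℂ) (hηsmooth : ContDiff ℝ (⊤ : ℕ∞) η)
    (hηsupp : Function.support η ⊆ Set.Ioo (-(1/2) : ℝ) (1/2))
    (hηmom : ∀ n : ℕ, n ≤ M₀ → ∫ x : ℝ, η x * (x:ℂ)^n = 0)
    (φ₀ : ℝ → ℂ) (hφsmooth : ContDiff ℝ (⊤ : ℕ∞) φ₀) (hφcpt : HasCompactSupport φ₀)
    (hφone : ∀ ξ : ℝ, |ξ| ≤ 4/3 → φ₀ ξ = 1)
    (hφzero : ∀ ξ : ℝ, 3/2 ≤ |ξ| → φ₀ ξ = 0) :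
    ∃ C : ℝ, 0 < C ∧ ∀ (m : ℕ) (L : Finset ℤ),
      (∀ l ∈ L, (m:ℤ) ≤ l) → 2^m ≤ L.card →
      ∀ P : ℤ → Finset ℝ,
      (∀ l ∈ L, ↑(P l) ⊆ Set.Icc (0:ℝ) 1) →
      (∀ l ∈ L, ∀ x ∈ P l, ∀ y ∈ P l, x ≠ y → (2:ℝ)^((m:ℤ) - l) ≤ |x - y|) →
      ∀ a : ℤ → ℝ → ℂ, (∀ l ∈ L, ∀ x ∈ P l, ‖a l x‖ ≤ 1) →
      FNorm φ₀ p q s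
          (fun y => ∑ l ∈ L, ((2:ℝ)^(-(l:ℝ)*s) : ℝ) *
            ∑ x ∈ P l, a l x * η ((2:ℝ)^l * (y - x))) ≤
        ENNReal.ofReal (C * ((2:ℝ)^(-(m:ℝ)) * (L.card : ℝ))^(1/q)) := by
  have hη : IsTestFn η := ⟨hηsmooth, hηsupp.trans Set.Ioo_subset_Icc_self⟩
  have hq0 : 0 < q := by linarith
  have hp0 : 0 < p := by linarith
  have hr : 1 ≤ p / q := by rwa [le_div_iff₀ hq0, one_mul]
  obtain ⟨δ, C, hδ, hC, hLP⟩ := exists_LPop_le hs hη hηmom hφsmooth hφcpt hφone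
  obtain ⟨K, hK, hmoment⟩ := exists_lintegral_bumpSum_rpow_le hr
  have hmass := bumpMass_nonneg
  set S := ∑' j, expDecay δ j with hSdef
  have hS : 0 < S := tsum_expDecay_pos hδ
  set W := 4 * bumpMass * 2 with hWdef
  set D := (C * S * W) ^ (q - 1) * C * S with hD
  have hD0 : 0 ≤ D := by positivity
  refine ⟨D ^ (1 / q) * K ^ (1 / p) + 1, by positivity, ?_⟩
  intro m L hL hcard P hP hsep a ha
  have hm : (2:ℝ) ^ (-(m:ℝ)) = (2:ℝ) ^ (-(m:ℤ)) := by
    rw [← Real.rpow_intCast]; push_cast; rfl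
  rw [hm]
  have hA : 1 ≤ (2:ℝ) ^ (-(m:ℤ)) * L.card := by
    rw [zpow_neg, zpow_natCast, ← div_eq_inv_mul, le_div_iff₀ (by positivity), one_mul]
    exact_mod_cast hcard
  have hL0 : ∀ l ∈ L, 0 ≤ l := fun l hl => (Int.natCast_nonneg m).trans (hL l hl)
  have hW : ∀ y, ∀ l ∈ L, ∑ x ∈ P l, bump ((2:ℝ) ^ l) x y ≤ W := by
    intro y l hl
    simp_rw [bump_comm _ _ y]
    refine (sum_bump_le (by positivity) (by positivity) (P l) (hsep l hl) y).trans ?_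
    have h1 : (2:ℝ) ^ l * (2:ℝ) ^ ((m:ℤ) - l) = (2:ℝ) ^ m := by
      rw [← zpow_add₀ two_ne_zero, add_sub_cancel, zpow_natCast]
    have h2 : 1 / (2:ℝ) ^ m ≤ 1 := by
      rw [div_le_one (by positivity)]; exact one_le_pow₀ one_le_two
    rw [h1, hWdef]
    gcongr
    linarith
  set g : ℝ → ℂ := fun y => ∑ l ∈ L, ((2:ℝ)^(-(l:ℝ)*s) : ℝ) *
            ∑ x ∈ P l, a l x * η ((2:ℝ)^l * (y - x)) with hg
  have hpt : ∀ y, ∑' k : ℕ, ENNReal.ofReal ((2:ℝ)^((k:ℝ)*s*q)) *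
      (ENNReal.ofReal ‖LPop φ₀ k g y‖)^q ≤ ENNReal.ofReal (D * bumpSum P L y) := by
    intro y
    have h1 : ∀ k : ℕ, ENNReal.ofReal ((2:ℝ)^((k:ℝ)*s*q)) * (ENNReal.ofReal ‖LPop φ₀ k g y‖)^q =
        ENNReal.ofReal (((2:ℝ) ^ ((k:ℝ) * s) * ‖LPop φ₀ k g y‖) ^ q) := by
      intro k
      rw [ENNReal.ofReal_rpow_of_nonneg (norm_nonneg _) hq0.le,
        ← ENNReal.ofReal_mul (by positivity), Real.mul_rpow (by positivity) (norm_nonneg _),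
        ← Real.rpow_mul (by norm_num)]
    simp_rw [h1]
    exact tsum_rpow_le hδ hq hC L _
      (fun l => Finset.sum_nonneg fun _ _ => (bump_pos (by positivity) _ _).le) (hW y) _
      (fun k => by positivity) fun k => hLP L P a hL0 ha k y
  set A := (2:ℝ) ^ (-(m:ℤ)) * L.card
  have hA0 : 0 ≤ A := by linarith
  have hmain : ∫⁻ y : ℝ, (∑' k : ℕ, ENNReal.ofReal ((2:ℝ)^((k:ℝ)*s*q)) *
      (ENNReal.ofReal ‖LPop φ₀ k g y‖)^q)^(p/q) ≤ ENNReal.ofReal ((D * A) ^ (p / q) * K) :=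
    (lintegral_mono fun y => ENNReal.rpow_le_rpow (hpt y) (by positivity)).trans
      (hmoment m P L D hD0 hsep hL hP hA)
  unfold FNorm
  refine (ENNReal.rpow_le_rpow hmain (by positivity)).trans ?_
  rw [ENNReal.ofReal_rpow_of_nonneg (by positivity) (by positivity)]
  refine ENNReal.ofReal_le_ofReal ?_
  rw [Real.mul_rpow (by positivity) hK, ← Real.rpow_mul (by positivity),
    show p / q * (1 / p) = 1 / q by field_simp, Real.mul_rpow hD0 hA0]
  have : 0 ≤ A ^ (1 / q) := by positivity
  nlinarith
end
end
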